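/- arXiv:1501.04814 — 2 statements merged into one kernel-verified Lean document; each statement's English description precedes it below -/
import Mathlib

section
/- One-sided convergence and quantization coefficients for multiscale Moran measures: In the multiscale Moran setting with ω ∈ G(χ), r ∈ (0,∞), let s_{k,r}(ω) be defined by Π_{i=1}^m (Σ_{j=1}^{N_i} (p_ij g_ij^r)^{s_{k,r}(ω)/(s_{k,r}(ω)+r)})^{N_{k,i}(ω)} = 1 where N_{k,i}(ω) := card{1 ≤ l ≤ k : ω_l = i}, let s_r > 0 satisfy Π_{i=1}^m (Σ_{j=1}^{N_i} (p_ij g_ij^r)^{s_r/(s_r+r)})^{χ_i} = 1, and let H̲_r(ω) := liminf_{k→∞} k|s_{k,r}(ω) − s_r|. Then: (a) if s_{k,r}(ω) ≥ s_r for all sufficiently large k, then Q̲_r^{s_r}(μ_ω) > 0, and if in addition H̲_r(ω) = ∞ then Q̄_r^{s_r}(μ_ω) = ∞; (b) if s_{k,r}(ω) ≤ s_r for all sufficiently large k, then Q̄_r^{s_r}(μ_ω) < ∞, and if in addition H̲_r(ω) = ∞ then Q̲_r^{s_r}(μ_ω) = 0. -/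
open MeasureTheory Filter Metric
open scoped ENNReal NNReal

/-- The `n`-th quantization error of order `r` for a measure `P`:
`e_{n,r}(P) = inf { (∫ d(x,α)^r dP)^{1/r} : α ⊆ E, 1 ≤ card α ≤ n }`. -/
noncomputable def quantError {E : Type*} [MetricSpace E] [MeasurableSpace E]
    (P : Measure E) (r : ℝ) (n : ℕ) : ℝ :=
  sInf {e : ℝ | ∃ α : Finset E, 1 ≤ α.card ∧ α.card ≤ n ∧
    e = (∫ x, infDist x (↑α : Set E) ^ r ∂P) ^ (1 / r)}

/-- The upper quantization dimension of order `r`. -/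
noncomputable def upperQuantDim {E : Type*} [MetricSpace E] [MeasurableSpace E]
    (P : Measure E) (r : ℝ) : ℝ :=
  limsup (fun n : ℕ => Real.log n / (- Real.log (quantError P r n))) atTop

/-- The lower quantization dimension of order `r`. -/
noncomputable def lowerQuantDim {E : Type*} [MetricSpace E] [MeasurableSpace E]
    (P : Measure E) (r : ℝ) : ℝ :=
  liminf (fun n : ℕ => Real.log n / (- Real.log (quantError P r n))) atTop

/-- The `s`-dimensional upper quantization coefficient of order `r`. -/
noncomputable def upperQuantCoeff {E : Type*} [MetricSpace E] [MeasurableSpace E]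
    (P : Measure E) (r s : ℝ) : ℝ≥0∞ :=
  limsup (fun n : ℕ => ENNReal.ofReal ((n : ℝ) ^ (1 / s) * quantError P r n)) atTop

/-- The `s`-dimensional lower quantization coefficient of order `r`. -/
noncomputable def lowerQuantCoeff {E : Type*} [MetricSpace E] [MeasurableSpace E]
    (P : Measure E) (r s : ℝ) : ℝ≥0∞ :=
  liminf (fun n : ℕ => ENNReal.ofReal ((n : ℝ) ^ (1 / s) * quantError P r n)) atTop

/-- A word `σ ∈ Ω_k = Π_{l=1}^k {0,…,N_{ω_l}-1}` for the multiscale Moran construction: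
the letter at (0-based) position `l` must be `< N (ω l)`. -/
def ValidWord {m : ℕ} (N : Fin m → ℕ) (ω : ℕ → Fin m) (σ : List ℕ) : Prop :=
  ∀ l : Fin σ.length, σ.get l < N (ω l)

/-- `N_{k,i}(ω)`: the number of `0 ≤ l < k` with `ω_l = i`. -/
noncomputable def freqCount {m : ℕ} (ω : ℕ → Fin m) (k : ℕ) (i : Fin m) : ℕ :=
  ((Finset.range k).filter (fun l => ω l = i)).card


/-- product weight along a word -/
noncomputable def wordW {m : ℕ} (ω : ℕ → Fin m) (f : Fin m → ℕ → ℝ) (σ : List ℕ) : ℝ :=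
  ∏ l : Fin σ.length, f (ω l) (σ.get l)

lemma wordW_eq {m : ℕ} (ω : ℕ → Fin m) (f : Fin m → ℕ → ℝ) (σ : List ℕ) :
    wordW ω f σ = ∏ l ∈ Finset.range σ.length, f (ω l) (σ.getD l 0) := by
  rw [wordW, Finset.prod_range]
  refine Finset.prod_congr rfl fun l _ => ?_
  simp

lemma wordW_nil {m : ℕ} (ω : ℕ → Fin m) (f : Fin m → ℕ → ℝ) : wordW ω f [] = 1 := by
  simp [wordW]

lemma wordW_append {m : ℕ} (ω : ℕ → Fin m) (f : Fin m → ℕ → ℝ) (σ : List ℕ) (j : ℕ) :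
    wordW ω f (σ ++ [j]) = wordW ω f σ * f (ω σ.length) j := by
  rw [wordW_eq, wordW_eq]
  have : (σ ++ [j]).length = σ.length + 1 := by simp
  rw [this, Finset.prod_range_succ]
  congr 1
  · refine Finset.prod_congr rfl fun l hl => ?_
    rw [List.getD_append _ _ _ _ (Finset.mem_range.1 hl)]
  · simp

lemma validWord_append {m : ℕ} {N : Fin m → ℕ} {ω : ℕ → Fin m} {σ : List ℕ} {j : ℕ} :
    ValidWord N ω (σ ++ [j]) ↔ ValidWord N ω σ ∧ j < N (ω σ.length) := by
  unfold ValidWord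
  constructor
  · intro h
    constructor
    · intro l
      have := h ⟨l, by simp⟩
      simpa [List.getElem_append] using this
    · have := h ⟨σ.length, by simp⟩
      simpa using this
  · rintro ⟨h1, h2⟩ ⟨l, hl⟩
    simp only [List.length_append, List.length_singleton] at hl
    by_cases hl' : l < σ.length
    · have := h1 ⟨l, hl'⟩
      simpa [List.getElem_append, hl'] using this
    · have : l = σ.length := by omega
      subst this
      simpa using h2

lemma validWord_nil {m : ℕ} {N : Fin m → ℕ} {ω : ℕ → Fin m} : ValidWord N ω [] := by
  intro l
  exact l.elim0

/-- induction over valid words -/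
lemma validWord_induction {m : ℕ} {N : Fin m → ℕ} {ω : ℕ → Fin m} {Q : List ℕ → Prop}
    (h0 : Q [])
    (hs : ∀ σ, ValidWord N ω σ → ∀ j < N (ω σ.length), Q σ → Q (σ ++ [j])) :
    ∀ σ, ValidWord N ω σ → Q σ := by
  intro σ
  induction σ using List.reverseRecOn with
  | nil => exact fun _ => h0
  | append_singleton σ j ih =>
    intro h
    obtain ⟨h1, h2⟩ := validWord_append.1 h
    exact hs σ h1 j h2 (ih h1)

/-- finite maximal antichain of words -/
structure IsCut {m : ℕ} {E : Type*} [MetricSpace E] (N : Fin m → ℕ) (ω : ℕ → Fin m)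
    (J : List ℕ → Set E) (β : ℝ) (T : Finset (List ℕ)) : Prop where
  valid : ∀ σ ∈ T, ValidWord N ω σ
  sep : ∀ σ ∈ T, ∀ τ ∈ T, σ ≠ τ → ∀ x ∈ J σ, ∀ y ∈ J τ,
    β * max (diam (J σ)) (diam (J τ)) ≤ dist x y
  sum : ∀ w : List ℕ → ℝ, (∀ σ, ValidWord N ω σ →
    ∑ j ∈ Finset.range (N (ω σ.length)), w (σ ++ [j]) = w σ) → ∑ σ ∈ T, w σ = w []

/-- the one step refinement -/
noncomputable def nextWords {m : ℕ} (N : Fin m → ℕ) (ω : ℕ → Fin m) (c : List ℕ → ℝ) (ε : ℝ)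
    (σ : List ℕ) : Finset (List ℕ) :=
  open Classical in
  if c σ < ε then {σ} else (Finset.range (N (ω σ.length))).image (fun j => σ ++ [j])

lemma mem_nextWords {m : ℕ} {N : Fin m → ℕ} {ω : ℕ → Fin m} {c : List ℕ → ℝ} {ε : ℝ}
    {σ τ : List ℕ} : τ ∈ nextWords N ω c ε σ ↔
      (c σ < ε ∧ τ = σ) ∨ (ε ≤ c σ ∧ ∃ j < N (ω σ.length), τ = σ ++ [j]) := by
  unfold nextWords
  split_ifs with h
  · simp [h, not_le.2 h]
  · simp [h, not_lt.1 h, eq_comm]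

lemma IsCut.next {m : ℕ} {E : Type*} [MetricSpace E] {N : Fin m → ℕ} {ω : ℕ → Fin m}
    {J : List ℕ → Set E} {β : ℝ} (hβ : 0 < β)
    (hne : ∀ σ, ValidWord N ω σ → (J σ).Nonempty)
    (hbd : ∀ σ, ValidWord N ω σ → Bornology.IsBounded (J σ))
    (hdi : ∀ σ, ValidWord N ω σ → 0 < diam (J σ))
    (hJsub : ∀ σ : List ℕ, ValidWord N ω σ → ∀ j < N (ω σ.length), J (σ ++ [j]) ⊆ J σ)
    (hsep : ∀ σ : List ℕ, ValidWord N ω σ →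
      ∀ j₁ j₂ : ℕ, j₁ < N (ω σ.length) → j₂ < N (ω σ.length) → j₁ ≠ j₂ →
      ∀ x ∈ J (σ ++ [j₁]), ∀ y ∈ J (σ ++ [j₂]),
        β * max (diam (J (σ ++ [j₁]))) (diam (J (σ ++ [j₂]))) ≤ dist x y)
    (c : List ℕ → ℝ) (ε : ℝ)
    {T : Finset (List ℕ)} (hT : IsCut N ω J β T) :
    IsCut N ω J β (T.biUnion (nextWords N ω c ε)) := by
  have hv : ∀ σ ∈ T, ∀ τ ∈ nextWords N ω c ε σ, ValidWord N ω τ ∧ J τ ⊆ J σ := by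
    intro σ hσ τ hτ
    rcases mem_nextWords.1 hτ with ⟨_, rfl⟩ | ⟨_, j, hj, rfl⟩
    · exact ⟨hT.valid _ hσ, subset_rfl⟩
    · exact ⟨validWord_append.2 ⟨hT.valid _ hσ, hj⟩, hJsub _ (hT.valid _ hσ) _ hj⟩
  refine ⟨?_, ?_, ?_⟩
  · intro τ hτ
    obtain ⟨σ, hσ, h⟩ := Finset.mem_biUnion.1 hτ
    exact (hv σ hσ τ h).1
  · intro τ₁ h₁ τ₂ h₂ hne12 x hx y hy
    obtain ⟨σ₁, hσ₁, h₁⟩ := Finset.mem_biUnion.1 h₁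
    obtain ⟨σ₂, hσ₂, h₂⟩ := Finset.mem_biUnion.1 h₂
    by_cases hs : σ₁ = σ₂
    · subst hs
      rcases mem_nextWords.1 h₁ with ⟨h, rfl⟩ | ⟨h, j, hj, rfl⟩ <;>
      rcases mem_nextWords.1 h₂ with ⟨h', h''⟩ | ⟨h', j', hj', rfl⟩
      · exact absurd h''.symm hne12
      · linarith
      · linarith
      · exact hsep _ (hT.valid _ hσ₁) j j' hj hj' (by rintro rfl; exact hne12 rfl) x hx y hy
    · have a := (hv σ₁ hσ₁ _ h₁).2
      have b := (hv σ₂ hσ₂ _ h₂).2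
      refine le_trans ?_ (hT.sep σ₁ hσ₁ σ₂ hσ₂ hs x (a hx) y (b hy))
      have := diam_mono a (hbd _ (hT.valid _ hσ₁))
      have := diam_mono b (hbd _ (hT.valid _ hσ₂))
      gcongr
  · intro w hw
    rw [Finset.sum_biUnion]
    · rw [← hT.sum w hw]
      refine Finset.sum_congr rfl fun σ hσ => ?_
      unfold nextWords
      split_ifs with h
      · simp
      · rw [Finset.sum_image (by intro a _ b _ h; simpa using h)]
        exact hw σ (hT.valid _ hσ)
    · intro σ₁ hσ₁ σ₂ hσ₂ hs
      refine Finset.disjoint_left.2 fun τ h₁ h₂ => ?_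
      have a := hv σ₁ hσ₁ _ h₁
      have b := hv σ₂ hσ₂ _ h₂
      obtain ⟨x, hx⟩ := hne τ a.1
      have := hT.sep σ₁ hσ₁ σ₂ hσ₂ hs x (a.2 hx) x (b.2 hx)
      rw [dist_self] at this
      have h3 := hdi _ (hT.valid _ hσ₁)
      have h4 : 0 < max (diam (J σ₁)) (diam (J σ₂)) := lt_max_of_lt_left h3
      have := mul_pos hβ h4
      linarith

/-- existence of cuts -/
lemma exists_isCut {m : ℕ} {E : Type*} [MetricSpace E] {N : Fin m → ℕ} {ω : ℕ → Fin m}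
    {J : List ℕ → Set E} {β : ℝ} (hβ : 0 < β)
    (hne : ∀ σ, ValidWord N ω σ → (J σ).Nonempty)
    (hbd : ∀ σ, ValidWord N ω σ → Bornology.IsBounded (J σ))
    (hdi : ∀ σ, ValidWord N ω σ → 0 < diam (J σ))
    (hJsub : ∀ σ : List ℕ, ValidWord N ω σ → ∀ j < N (ω σ.length), J (σ ++ [j]) ⊆ J σ)
    (hsep : ∀ σ : List ℕ, ValidWord N ω σ →
      ∀ j₁ j₂ : ℕ, j₁ < N (ω σ.length) → j₂ < N (ω σ.length) → j₁ ≠ j₂ →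
      ∀ x ∈ J (σ ++ [j₁]), ∀ y ∈ J (σ ++ [j₂]),
        β * max (diam (J (σ ++ [j₁]))) (diam (J (σ ++ [j₂]))) ≤ dist x y)
    (q : Fin m → ℕ → ℝ) (η ρ : ℝ) (hη : 0 < η) (hρ : ρ < 1)
    (hq : ∀ i, ∀ j < N i, η ≤ q i j ∧ q i j ≤ ρ)
    (ε : ℝ) (hε : 0 < ε) (hε1 : ε ≤ 1) :
    ∃ T, IsCut N ω J β T ∧ ∀ σ ∈ T, η * ε ≤ wordW ω q σ ∧ wordW ω q σ < ε := by
  by_cases hN : ∃ i, 0 < N i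
  swap
  · push Not at hN
    have hw : ∀ w : List ℕ → ℝ, (∀ σ, ValidWord N ω σ →
      ∑ j ∈ Finset.range (N (ω σ.length)), w (σ ++ [j]) = w σ) → w [] = 0 := by
      intro w hw
      rw [← hw [] validWord_nil, Nat.le_zero.1 (hN _)]
      simp
    exact ⟨∅, ⟨by simp, by simp, fun w h => by simp [hw w h]⟩, by simp⟩
  obtain ⟨i0, hi0⟩ := hN
  have hηρ : η ≤ ρ := (hq i0 0 hi0).1.trans (hq i0 0 hi0).2
  have hρ0 : 0 < ρ := hη.trans_le hηρ
  have hWpos : ∀ σ, ValidWord N ω σ → 0 < wordW ω q σ ∧ wordW ω q σ ≤ ρ ^ σ.length := by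
    refine validWord_induction (by simp [wordW_nil]) ?_
    rintro σ hσ j hj ⟨h1, h2⟩
    have := hq _ j hj
    rw [wordW_append]
    have h3 : 0 < q (ω σ.length) j := by linarith
    refine ⟨mul_pos h1 h3, ?_⟩
    rw [List.length_append, List.length_singleton, pow_succ]
    have := this.2
    gcongr
  have key : ∀ k : ℕ, ∃ T, IsCut N ω J β T ∧ ∀ σ ∈ T, η * ε ≤ wordW ω q σ ∧
      (wordW ω q σ < ε ∨ σ.length = k) := by
    intro k
    induction k with
    | zero =>
      refine ⟨{[]}, ⟨?_, ?_, ?_⟩, ?_⟩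
      · simp [validWord_nil]
      · simp
      · simp
      · simp only [Finset.mem_singleton, forall_eq, wordW_nil, List.length_nil, or_true, and_true]
        nlinarith
    | succ k ih =>
      obtain ⟨T, hT, h⟩ := ih
      refine ⟨_, hT.next hβ hne hbd hdi hJsub hsep (wordW ω q) ε, ?_⟩
      intro τ hτ
      obtain ⟨σ, hσ, hτ⟩ := Finset.mem_biUnion.1 hτ
      rcases mem_nextWords.1 hτ with ⟨h1, rfl⟩ | ⟨h1, j, hj, rfl⟩
      · exact ⟨(h _ hσ).1, Or.inl h1⟩
      · have h2 := h _ hσ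
        have h3 : σ.length = k := h2.2.resolve_left (not_lt.2 h1)
        refine ⟨?_, Or.inr (by simp [h3])⟩
        rw [wordW_append, mul_comm η]
        have := (hq _ j hj).1
        have h4 := (hWpos σ (hT.valid _ hσ)).1.le
        gcongr
  obtain ⟨k, hk⟩ := exists_pow_lt_of_lt_one hε hρ
  obtain ⟨T, hT, h⟩ := key k
  refine ⟨T, hT, fun σ hσ => ⟨(h σ hσ).1, ?_⟩⟩
  rcases (h σ hσ).2 with h1 | h1
  · exact h1
  · have := (hWpos σ (hT.valid _ hσ)).2
    rw [h1] at this
    linarith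

lemma exists_pos_lower {m : ℕ} (N : Fin m → ℕ) (f : Fin m → ℕ → ℝ)
    (hf : ∀ i, ∀ j < N i, 0 < f i j) : ∃ η, 0 < η ∧ ∀ i, ∀ j < N i, η ≤ f i j := by
  have h1 : ∀ i, ∃ η, 0 < η ∧ ∀ j < N i, η ≤ f i j := by
    intro i
    have : ∀ n, (∀ j < n, 0 < f i j) → ∃ η, 0 < η ∧ ∀ j < n, η ≤ f i j := by
      intro n
      induction n with
      | zero => exact fun _ => ⟨1, one_pos, by simp⟩
      | succ n ih =>
        intro h
        obtain ⟨η, h0, h1⟩ := ih fun j hj => h j (by omega)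
        refine ⟨min η (f i n), lt_min h0 (h n (by omega)), fun j hj => ?_⟩
        rcases Nat.lt_succ_iff_lt_or_eq.1 hj with hj | rfl
        · exact (min_le_left _ _).trans (h1 j hj)
        · exact min_le_right _ _
    exact this _ (hf i)
  choose e he0 he using h1
  rcases isEmpty_or_nonempty (Fin m) with hm | hm
  · exact ⟨1, one_pos, fun i => hm.elim i⟩
  obtain ⟨i, hi⟩ := Finite.exists_min e
  exact ⟨e i, he0 i, fun i' j hj => (hi i').trans (he i' j hj)⟩

lemma alg_exp {n K r s : ℝ} (hn : 0 < n) (hK : 0 < K) (hr : 0 < r) (hs : 0 < s) :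
    n ^ (1 / s) * (n * (K / n) ^ ((s + r) / s)) ^ (1 / r) = K ^ ((s + r) / (s * r)) := by
  rw [Real.mul_rpow hn.le (by positivity), ← Real.rpow_mul (by positivity),
    Real.div_rpow hK.le hn.le, ← mul_assoc, ← Real.rpow_add hn]
  have : (s + r) / s * (1 / r) = (s + r) / (s * r) := by field_simp
  rw [this]
  have h2 : 1 / s + 1 / r = (s + r) / (s * r) := by field_simp; ring
  rw [h2]
  have : n ^ ((s + r) / (s * r)) ≠ 0 := by positivity
  field_simp

lemma integrable_infDist_rpow {E : Type*} [MetricSpace E] [MeasurableSpace E] [BorelSpace E]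
    (μ : Measure E) [IsProbabilityMeasure μ] {K : Set E} (hK : IsCompact K) (hμK : μ K = 1)
    {r : ℝ} (hr : 0 < r) (α : Set E) : Integrable (fun x => infDist x α ^ r) μ := by
  have hc : Continuous (fun x => infDist x α ^ r) :=
    (continuous_infDist_pt α).rpow_const (fun _ => Or.inr hr.le)
  have h1 : IntegrableOn (fun x => infDist x α ^ r) K μ := hc.continuousOn.integrableOn_compact hK
  have h2 : μ.restrict K = μ := by
    apply Measure.restrict_eq_self_of_ae_mem
    exact (prob_compl_eq_zero_iff hK.measurableSet).2 hμK
  rwa [IntegrableOn, h2] at h1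

lemma quantError_le {E ι : Type*} [MetricSpace E] [MeasurableSpace E] [BorelSpace E]
    (μ : Measure E) [IsProbabilityMeasure μ] {K : Set E} (hK : IsCompact K) (hμK : μ K = 1)
    {r : ℝ} (hr : 0 < r) (J : ι → Set E) (T : Finset ι)
    (hJc : ∀ σ ∈ T, IsCompact (J σ)) (hJn : ∀ σ ∈ T, (J σ).Nonempty)
    (hdisj : Set.PairwiseDisjoint (↑T : Set ι) J)
    (hsum : ∑ σ ∈ T, μ.real (J σ) = 1) (n : ℕ) (hn : T.card ≤ n) (B : ℝ)
    (hB : ∑ σ ∈ T, μ.real (J σ) * diam (J σ) ^ r ≤ B) :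
    quantError μ r n ≤ B ^ (1 / r) := by
  classical
  have hne : T.Nonempty := by
    rw [Finset.nonempty_iff_ne_empty]; rintro rfl; simp at hsum
  have : Nonempty E := ⟨(hJn _ hne.choose_spec).choose⟩
  choose! a ha using hJn
  set α : Finset E := T.image a with hα
  have hmeas : ∀ σ ∈ T, MeasurableSet (J σ) := fun σ hσ => (hJc σ hσ).measurableSet
  have hint := integrable_infDist_rpow μ hK hμK hr (↑α : Set E)
  have hU : μ.real (⋃ σ ∈ T, J σ) = 1 := by
    rw [measureReal_biUnion_finset hdisj hmeas, hsum]
  have hU' : μ.restrict (⋃ σ ∈ T, J σ) = μ := by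
    apply Measure.restrict_eq_self_of_ae_mem
    refine (prob_compl_eq_zero_iff (T.measurableSet_biUnion hmeas)).2 ?_
    rw [Measure.real, ENNReal.toReal_eq_one_iff] at hU
    exact hU
  have hI : ∫ x, infDist x (↑α : Set E) ^ r ∂μ ≤ B := by
    refine le_trans ?_ hB
    conv_lhs => rw [← hU']
    rw [integral_biUnion_finset T hmeas hdisj (fun σ _ => hint.integrableOn)]
    refine Finset.sum_le_sum fun σ hσ => ?_
    have : ∫ x in J σ, infDist x (↑α : Set E) ^ r ∂μ ≤ ∫ x in J σ, diam (J σ) ^ r ∂μ := by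
      refine setIntegral_mono_on hint.integrableOn (integrable_const _) (hmeas σ hσ) ?_
      intro x hx
      refine Real.rpow_le_rpow infDist_nonneg ?_ hr.le
      refine (infDist_le_dist_of_mem (y := a σ) ?_).trans ?_
      · simp only [hα, Finset.coe_image]
        exact ⟨σ, hσ, rfl⟩
      · exact dist_le_diam_of_mem (hJc σ hσ).isBounded hx (ha σ hσ)
    simpa using this
  have hI0 : 0 ≤ ∫ x, infDist x (↑α : Set E) ^ r ∂μ :=
    integral_nonneg fun x => Real.rpow_nonneg infDist_nonneg _
  refine le_trans (csInf_le ?_ ⟨α, ?_, ?_, rfl⟩) (Real.rpow_le_rpow hI0 hI (by positivity))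
  · refine ⟨0, ?_⟩
    rintro e ⟨α, -, -, rfl⟩
    exact Real.rpow_nonneg (integral_nonneg fun x => Real.rpow_nonneg infDist_nonneg _) _
  · exact Finset.card_pos.2 (hne.image a)
  · exact Finset.card_image_le.trans hn

lemma le_quantError {E ι : Type*} [MetricSpace E] [MeasurableSpace E] [BorelSpace E]
    (μ : Measure E) [IsProbabilityMeasure μ] {K : Set E} (hK : IsCompact K) (hμK : μ K = 1)
    {r : ℝ} (hr : 0 < r) (J : ι → Set E) (T : Finset ι) (β : ℝ) (hβ : 0 < β)
    (hJc : ∀ σ ∈ T, IsCompact (J σ)) (hKn : K.Nonempty)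
    (hdisj : Set.PairwiseDisjoint (↑T : Set ι) J)
    (hsep : ∀ σ ∈ T, ∀ τ ∈ T, σ ≠ τ → ∀ x ∈ J σ, ∀ y ∈ J τ,
      β * max (diam (J σ)) (diam (J τ)) ≤ dist x y)
    (n : ℕ) (hn1 : 1 ≤ n) (hn : 2 * n ≤ T.card) (B : ℝ) (hB0 : 0 ≤ B)
    (hB : ∀ σ ∈ T, B ≤ μ.real (J σ) * diam (J σ) ^ r) :
    (n * ((β / 2) ^ r * B)) ^ (1 / r) ≤ quantError μ r n := by
  classical
  obtain ⟨z, -⟩ := hKn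
  refine le_csInf ⟨_, {z}, by simp, by simpa using hn1, rfl⟩ ?_
  rintro e ⟨α, hα1, hαn, rfl⟩
  refine Real.rpow_le_rpow (by positivity) ?_ (by positivity)
  have hmeas : ∀ σ ∈ T, MeasurableSet (J σ) := fun σ hσ => (hJc σ hσ).measurableSet
  have hint := integrable_infDist_rpow μ hK hμK hr (↑α : Set E)
  have hαne : (↑α : Set E).Nonempty := Finset.card_pos.1 hα1
  set G := T.filter (fun σ => ∀ x ∈ J σ, β / 2 * diam (J σ) ≤ infDist x (↑α : Set E)) with hG
  set Bd := T.filter (fun σ => ¬ ∀ x ∈ J σ, β / 2 * diam (J σ) ≤ infDist x (↑α : Set E)) with hBd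
  have hcard : G.card + Bd.card = T.card := Finset.card_filter_add_card_filter_not _
  have hbad : ∀ σ ∈ Bd, ∃ a ∈ α, ∃ x ∈ J σ, dist x a < β / 2 * diam (J σ) := by
    intro σ hσ
    have := (Finset.mem_filter.1 hσ).2
    push Not at this
    obtain ⟨x, hx, h⟩ := this
    obtain ⟨a, ha, h'⟩ := (infDist_lt_iff hαne).1 h
    exact ⟨a, ha, x, hx, h'⟩
  have : Nonempty E := ⟨z⟩
  choose! a haα x hx hxa using hbad
  have hBdcard : Bd.card ≤ α.card := by
    refine Finset.card_le_card_of_injOn a haα ?_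
    intro σ hσ τ hτ h
    by_contra hne
    have h1 := hsep σ (Finset.mem_filter.1 hσ).1 τ (Finset.mem_filter.1 hτ).1 hne _ (hx σ hσ) _ (hx τ hτ)
    have h2 := hxa σ hσ
    have h3 := hxa τ hτ
    rw [← h] at h3
    have h4 := dist_triangle_right (x σ) (x τ) (a σ)
    have h5 := le_max_left (diam (J σ)) (diam (J τ))
    have h6 := le_max_right (diam (J σ)) (diam (J τ))
    nlinarith
  have hGn : n ≤ G.card := by omega
  have hGT : ∀ σ ∈ G, σ ∈ T := fun σ hσ => (Finset.mem_filter.1 hσ).1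
  calc (n : ℝ) * ((β / 2) ^ r * B) ≤ G.card * ((β / 2) ^ r * B) := by
        have : (n : ℝ) ≤ G.card := by exact_mod_cast hGn
        gcongr
    _ = ∑ σ ∈ G, (β / 2) ^ r * B := by simp
    _ ≤ ∑ σ ∈ G, ∫ x in J σ, infDist x (↑α : Set E) ^ r ∂μ := by
        refine Finset.sum_le_sum fun σ hσ => ?_
        have : ∫ x in J σ, (β / 2 * diam (J σ)) ^ r ∂μ ≤
            ∫ x in J σ, infDist x (↑α : Set E) ^ r ∂μ := by
          refine setIntegral_mono_on (integrable_const _) hint.integrableOn (hmeas σ (hGT σ hσ)) ?_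
          intro x hx
          have hd : 0 ≤ diam (J σ) := diam_nonneg
          exact Real.rpow_le_rpow (by positivity) ((Finset.mem_filter.1 hσ).2 x hx) hr.le
        refine le_trans ?_ this
        simp only [integral_const, measureReal_restrict_apply, MeasurableSet.univ, Set.univ_inter,
          smul_eq_mul]
        rw [Real.mul_rpow (by positivity) diam_nonneg]
        have := hB σ (hGT σ hσ)
        calc (β / 2) ^ r * B ≤ (β / 2) ^ r * (μ.real (J σ) * diam (J σ) ^ r) := by gcongr
          _ = _ := by ring
    _ = ∫ x in ⋃ σ ∈ G, J σ, infDist x (↑α : Set E) ^ r ∂μ := by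
        rw [integral_biUnion_finset G (fun σ hσ => hmeas σ (hGT σ hσ))
          (hdisj.subset fun σ hσ => hGT σ hσ) (fun σ _ => hint.integrableOn)]
    _ ≤ ∫ x, infDist x (↑α : Set E) ^ r ∂μ :=
        setIntegral_le_integral hint (Filter.Eventually.of_forall fun x =>
          Real.rpow_nonneg infDist_nonneg _)

/-- level sums -/
noncomputable def levelSum {m : ℕ} (N : Fin m → ℕ) (ω : ℕ → Fin m) (q : Fin m → ℕ → ℝ)
    (x : ℝ) (k : ℕ) : ℝ :=
  ∏ l ∈ Finset.range k, ∑ j ∈ Finset.range (N (ω l)), q (ω l) j ^ x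

lemma levelSum_eq {m : ℕ} (N : Fin m → ℕ) (ω : ℕ → Fin m) (q : Fin m → ℕ → ℝ) (x : ℝ) (k : ℕ) :
    levelSum N ω q x k =
      ∏ i, (∑ j ∈ Finset.range (N i), q i j ^ x) ^ (freqCount ω k i : ℝ) := by
  unfold levelSum freqCount
  rw [← Finset.prod_fiberwise (Finset.range k) ω]
  refine Finset.prod_congr rfl fun i _ => ?_
  rw [Real.rpow_natCast, ← Finset.prod_const]
  refine Finset.prod_congr rfl fun l hl => ?_
  rw [(Finset.mem_filter.1 hl).2]

lemma levelSum_le {m : ℕ} (N : Fin m → ℕ) (ω : ℕ → Fin m) (q : Fin m → ℕ → ℝ) (ρ : ℝ)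
    (hq : ∀ i, ∀ j < N i, 0 < q i j ∧ q i j ≤ ρ) (hρ0 : 0 < ρ) {u v : ℝ} (huv : u ≤ v) (k : ℕ) :
    levelSum N ω q v k ≤ ρ ^ (k * (v - u)) * levelSum N ω q u k := by
  have : ρ ^ (k * (v - u)) = ∏ l ∈ Finset.range k, ρ ^ (v - u) := by
    rw [Finset.prod_const, Finset.card_range, mul_comm, Real.rpow_mul hρ0.le, Real.rpow_natCast]
  unfold levelSum
  rw [this, ← Finset.prod_mul_distrib]
  refine Finset.prod_le_prod ?_ ?_
  · intro l _
    exact Finset.sum_nonneg fun j hj => Real.rpow_nonneg (hq _ j (Finset.mem_range.1 hj)).1.le _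
  · intro l _
    rw [Finset.mul_sum]
    refine Finset.sum_le_sum fun j hj => ?_
    have h := hq (ω l) j (Finset.mem_range.1 hj)
    have h1 : q (ω l) j ^ v = q (ω l) j ^ (v - u) * q (ω l) j ^ u := by
      rw [← Real.rpow_add h.1]; ring_nf
    rw [h1]
    have h2 : q (ω l) j ^ (v - u) ≤ ρ ^ (v - u) := Real.rpow_le_rpow h.1.le h.2 (by linarith)
    have h3 := Real.rpow_nonneg h.1.le u
    gcongr

lemma cut_main
    (d m : ℕ)
    (N : Fin m → ℕ) (hN : ∀ i, 2 ≤ N i)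
    (g : Fin m → ℕ → ℝ) (hg : ∀ i, ∀ j < N i, 0 < g i j ∧ g i j < 1)
    (p : Fin m → ℕ → ℝ) (hp : ∀ i, ∀ j < N i, 0 < p i j)
    (hp1 : ∀ i, ∑ j ∈ Finset.range (N i), p i j = 1)
    (ω : ℕ → Fin m)
    (J : List ℕ → Set (EuclideanSpace ℝ (Fin d)))
    (hJ0 : IsCompact (J []) ∧ (J []).Nonempty ∧ J [] = closure (interior (J [])))
    (hJsub : ∀ σ : List ℕ, ValidWord N ω σ → ∀ j < N (ω σ.length), J (σ ++ [j]) ⊆ J σ)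
    (hJsim : ∀ σ : List ℕ, ValidWord N ω σ → ∀ j < N (ω σ.length),
      ∃ S : EuclideanSpace ℝ (Fin d) → EuclideanSpace ℝ (Fin d),
        (∀ x y, dist (S x) (S y) = g (ω σ.length) j * dist x y) ∧ S '' J σ = J (σ ++ [j]))
    (β : ℝ) (hβ : 0 < β) (hsep : ∀ σ : List ℕ, ValidWord N ω σ →
      ∀ j₁ j₂ : ℕ, j₁ < N (ω σ.length) → j₂ < N (ω σ.length) → j₁ ≠ j₂ →
      ∀ x ∈ J (σ ++ [j₁]), ∀ y ∈ J (σ ++ [j₂]),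
        β * max (diam (J (σ ++ [j₁]))) (diam (J (σ ++ [j₂]))) ≤ dist x y)
    (μ : Measure (EuclideanSpace ℝ (Fin d))) [IsProbabilityMeasure μ]
    (hμ : ∀ σ : List ℕ, ValidWord N ω σ →
      μ (J σ) = ENNReal.ofReal (∏ l : Fin σ.length, p (ω l) (σ.get l)))
    (r : ℝ) (hr : 0 < r) (q : Fin m → ℕ → ℝ) (hqdef : q = fun i j => p i j * g i j ^ r)
    (η ρ : ℝ) (hη : 0 < η) (hρ : ρ < 1) (hq : ∀ i, ∀ j < N i, η ≤ q i j ∧ q i j ≤ ρ)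
    (t : ℝ) (ht : 0 < t) :
    ∃ D, 0 < D ∧ ∀ ε, 0 < ε → ε ≤ 1 → ∃ T : Finset (List ℕ),
      (∀ σ ∈ T, IsCompact (J σ)) ∧ (∀ σ ∈ T, (J σ).Nonempty) ∧
      Set.PairwiseDisjoint (↑T : Set (List ℕ)) J ∧
      (∀ σ ∈ T, ∀ τ ∈ T, σ ≠ τ → ∀ x ∈ J σ, ∀ y ∈ J τ,
        β * max (diam (J σ)) (diam (J τ)) ≤ dist x y) ∧
      ∑ σ ∈ T, μ.real (J σ) = 1 ∧
      (∀ σ ∈ T, D * (η * ε) ≤ μ.real (J σ) * diam (J σ) ^ r ∧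
        μ.real (J σ) * diam (J σ) ^ r ≤ D * ε) ∧
      ∀ (M : ℝ) (k0 : ℕ), ε ≤ η ^ k0 →
        ((∀ k ≥ k0, levelSum N ω q t k ≤ M) → T.card * (η * ε) ^ t ≤ M) ∧
        ((∀ k ≥ k0, M ≤ levelSum N ω q t k) → M ≤ T.card * ε ^ t) := by
  have hi : Nonempty (Fin m) := ⟨ω 0⟩
  have hηρ : η ≤ ρ := by
    have := hN (ω 0)
    exact (hq (ω 0) 0 (by omega)).1.trans (hq (ω 0) 0 (by omega)).2
  have hη1 : η < 1 := by linarith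
  have hqpos : ∀ i, ∀ j < N i, 0 < q i j := fun i j hj => hη.trans_le (hq i j hj).1
  have hcpt : ∀ σ, ValidWord N ω σ → IsCompact (J σ) := by
    refine validWord_induction hJ0.1 ?_
    intro σ hσ j hj h
    obtain ⟨S, hS, hSJ⟩ := hJsim σ hσ j hj
    rw [← hSJ]
    refine h.image ?_
    have : LipschitzWith (Real.toNNReal (g (ω σ.length) j)) S := by
      refine LipschitzWith.of_dist_le_mul fun x y => ?_
      rw [hS, Real.coe_toNNReal _ (hg _ j hj).1.le]
    exact this.continuous
  have hne : ∀ σ, ValidWord N ω σ → (J σ).Nonempty := by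
    refine validWord_induction hJ0.2.1 ?_
    intro σ hσ j hj h
    obtain ⟨S, hS, hSJ⟩ := hJsim σ hσ j hj
    rw [← hSJ]
    exact h.image _
  have hbd : ∀ σ, ValidWord N ω σ → Bornology.IsBounded (J σ) := fun σ h => (hcpt σ h).isBounded
  have hdiam : ∀ σ, ValidWord N ω σ → diam (J σ) = wordW ω g σ * diam (J []) := by
    refine validWord_induction (by simp [wordW_nil]) ?_
    intro σ hσ j hj h
    have hb := hbd _ (validWord_append.2 ⟨hσ, hj⟩)
    obtain ⟨S, hS, hSJ⟩ := hJsim σ hσ j hj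
    have hgp := (hg _ j hj).1
    have h1 : diam (J (σ ++ [j])) = g (ω σ.length) j * diam (J σ) := by
      rw [← hSJ] at hb ⊢
      apply le_antisymm
      · refine diam_le_of_forall_dist_le (mul_nonneg hgp.le diam_nonneg) ?_
        rintro _ ⟨x, hx, rfl⟩ _ ⟨y, hy, rfl⟩
        rw [hS]
        have := dist_le_diam_of_mem (hbd σ hσ) hx hy
        gcongr
      · rw [mul_comm, ← le_div_iff₀ hgp]
        refine diam_le_of_forall_dist_le (div_nonneg diam_nonneg hgp.le) ?_
        intro x hx y hy
        rw [le_div_iff₀ hgp, mul_comm, ← hS]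
        exact dist_le_diam_of_mem hb ⟨x, hx, rfl⟩ ⟨y, hy, rfl⟩
    rw [h1, h, wordW_append]
    ring
  have hgpos : ∀ σ, ValidWord N ω σ → 0 < wordW ω g σ := by
    refine validWord_induction (by simp [wordW_nil]) ?_
    intro σ hσ j hj h
    rw [wordW_append]
    exact mul_pos h (hg _ j hj).1
  have hppos : ∀ σ, ValidWord N ω σ → 0 < wordW ω p σ := by
    refine validWord_induction (by simp [wordW_nil]) ?_
    intro σ hσ j hj h
    rw [wordW_append]
    exact mul_pos h (hp _ j hj)
  have hμr : ∀ σ, ValidWord N ω σ → μ.real (J σ) = wordW ω p σ := by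
    intro σ hσ
    have h1 : μ (J σ) = ENNReal.ofReal (wordW ω p σ) := hμ σ hσ
    rw [Measure.real, h1, ENNReal.toReal_ofReal (hppos σ hσ).le]
  have hD0 : 0 < diam (J []) := by
    by_contra hcon
    have hN0 := hN (ω 0)
    have hv0 : ValidWord N ω ([] ++ [0]) := validWord_append.2 ⟨validWord_nil, by simp; omega⟩
    have heq : J ([] ++ [0]) = J [] := by
      apply Set.Subset.antisymm (hJsub [] validWord_nil 0 (by simp; omega))
      intro x hx
      obtain ⟨y, hy⟩ := hne _ hv0
      have hy' := hJsub [] validWord_nil 0 (by simp; omega) hy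
      have := dist_le_diam_of_mem hJ0.1.isBounded hx hy'
      have h0 : dist x y = 0 := le_antisymm (this.trans (not_lt.1 hcon)) dist_nonneg
      rw [dist_eq_zero.1 h0]
      exact hy
    have h1 := hμr _ hv0
    rw [heq, hμr _ validWord_nil, wordW_append, wordW_nil, one_mul] at h1
    have h2 : ∑ j ∈ Finset.range 2, p (ω 0) j ≤ 1 := by
      rw [← hp1 (ω 0)]
      refine Finset.sum_le_sum_of_subset_of_nonneg (Finset.range_subset_range.2 hN0) ?_
      intro j hj _
      exact (hp _ j (Finset.mem_range.1 hj)).le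
    rw [Finset.sum_range_succ, Finset.sum_range_one] at h2
    have h3 := hp (ω 0) 1 (by omega)
    simp only [List.length_nil] at h1
    linarith
  have hdi : ∀ σ, ValidWord N ω σ → 0 < diam (J σ) := by
    intro σ hσ
    rw [hdiam σ hσ]
    exact mul_pos (hgpos σ hσ) hD0
  have hqW : ∀ σ, ValidWord N ω σ → wordW ω q σ = wordW ω p σ * wordW ω g σ ^ r := by
    refine validWord_induction (by simp [wordW_nil]) ?_
    intro σ hσ j hj h
    rw [wordW_append, wordW_append, wordW_append, h,
      Real.mul_rpow (hgpos σ hσ).le (hg _ j hj).1.le, hqdef]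
    ring
  have hmass : ∀ σ, ValidWord N ω σ →
      μ.real (J σ) * diam (J σ) ^ r = diam (J []) ^ r * wordW ω q σ := by
    intro σ hσ
    rw [hμr σ hσ, hdiam σ hσ, hqW σ hσ, Real.mul_rpow (hgpos σ hσ).le diam_nonneg]
    ring
  have hqlow : ∀ σ, ValidWord N ω σ → η ^ σ.length ≤ wordW ω q σ := by
    refine validWord_induction (by simp [wordW_nil]) ?_
    intro σ hσ j hj h
    rw [wordW_append, List.length_append, List.length_singleton, pow_succ]
    have := (hq _ j hj).1
    have h4 : 0 ≤ wordW ω q σ := le_trans (by positivity) h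
    gcongr
  set Sm : Fin m → ℝ := fun i => ∑ j ∈ Finset.range (N i), q i j ^ t with hSm
  have hSpos : ∀ i, 0 < Sm i := by
    intro i
    refine Finset.sum_pos (fun j hj => Real.rpow_pos_of_pos (hqpos i j (Finset.mem_range.1 hj)) _) ?_
    exact ⟨0, Finset.mem_range.2 (by have := hN i; omega)⟩
  set ν : Fin m → ℕ → ℝ := fun i j => q i j ^ t / Sm i with hν
  have hνpos : ∀ σ, ValidWord N ω σ → 0 < wordW ω ν σ := by
    refine validWord_induction (by simp [wordW_nil]) ?_
    intro σ hσ j hj h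
    rw [wordW_append]
    exact mul_pos h (div_pos (Real.rpow_pos_of_pos (hqpos _ j hj) _) (hSpos _))
  have hνW : ∀ σ, ValidWord N ω σ →
      wordW ω q σ ^ t = wordW ω ν σ * levelSum N ω q t σ.length := by
    refine validWord_induction (by simp [wordW_nil, levelSum]) ?_
    intro σ hσ j hj h
    have h4 : 0 ≤ wordW ω q σ := le_trans (by positivity) (hqlow σ hσ)
    have h5 : levelSum N ω q t (σ ++ [j]).length =
        levelSum N ω q t σ.length * Sm (ω σ.length) := by
      rw [List.length_append, List.length_singleton, levelSum, Finset.prod_range_succ, ← levelSum]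
    rw [wordW_append, wordW_append, h5, Real.mul_rpow h4 (hqpos _ j hj).le, h]
    have := (hSpos (ω σ.length)).ne'
    simp only [hν]
    field_simp
  refine ⟨diam (J []) ^ r, Real.rpow_pos_of_pos hD0 r, fun ε hε hε1 => ?_⟩
  obtain ⟨T, hT, hTq⟩ := exists_isCut hβ hne hbd hdi hJsub hsep q η ρ hη hρ hq ε hε hε1
  have hsumν : ∑ σ ∈ T, wordW ω ν σ = 1 := by
    rw [hT.sum (wordW ω ν), wordW_nil]
    intro σ hσ
    simp only [wordW_append]
    rw [← Finset.mul_sum]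
    simp only [hν]
    rw [← Finset.sum_div, div_self (hSpos _).ne', mul_one]
  refine ⟨T, fun σ hσ => hcpt σ (hT.valid σ hσ), fun σ hσ => hne σ (hT.valid σ hσ), ?_, hT.sep, ?_,
    ?_, ?_⟩
  · intro σ hσ τ hτ hστ
    refine Set.disjoint_left.2 fun x hx hy => ?_
    have h1 := hT.sep σ hσ τ hτ hστ x hx x hy
    rw [dist_self] at h1
    have h4 : 0 < max (diam (J σ)) (diam (J τ)) := lt_max_of_lt_left (hdi _ (hT.valid _ hσ))
    have := mul_pos hβ h4
    linarith
  · rw [Finset.sum_congr rfl fun σ hσ => hμr σ (hT.valid σ hσ), hT.sum (wordW ω p), wordW_nil]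
    intro σ hσ
    simp only [wordW_append]
    rw [← Finset.mul_sum, hp1, mul_one]
  · intro σ hσ
    rw [hmass σ (hT.valid σ hσ)]
    have h0 : 0 ≤ diam (J []) ^ r := Real.rpow_nonneg diam_nonneg _
    exact ⟨mul_le_mul_of_nonneg_left (hTq σ hσ).1 h0,
      mul_le_mul_of_nonneg_left (hTq σ hσ).2.le h0⟩
  · intro M k0 hk0
    have hlen : ∀ σ ∈ T, k0 ≤ σ.length := by
      intro σ hσ
      have h1 : η ^ σ.length < η ^ k0 :=
        ((hqlow σ (hT.valid σ hσ)).trans_lt (hTq σ hσ).2).trans_le hk0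
      exact ((pow_lt_pow_iff_right_of_lt_one₀ hη hη1).1 h1).le
    constructor
    · intro h
      calc T.card * (η * ε) ^ t = ∑ σ ∈ T, (η * ε) ^ t := by simp
        _ ≤ ∑ σ ∈ T, wordW ω ν σ * M := by
            refine Finset.sum_le_sum fun σ hσ => ?_
            refine (Real.rpow_le_rpow (by positivity) (hTq σ hσ).1 ht.le).trans ?_
            rw [hνW σ (hT.valid σ hσ)]
            exact mul_le_mul_of_nonneg_left (h _ (hlen σ hσ)) (hνpos σ (hT.valid σ hσ)).le
        _ = M := by rw [← Finset.sum_mul, hsumν, one_mul]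
    · intro h
      calc M = ∑ σ ∈ T, wordW ω ν σ * M := by rw [← Finset.sum_mul, hsumν, one_mul]
        _ ≤ ∑ σ ∈ T, ε ^ t := by
            refine Finset.sum_le_sum fun σ hσ => ?_
            have h4 : 0 ≤ wordW ω q σ := le_trans (by positivity) (hqlow σ (hT.valid σ hσ))
            refine le_trans ?_ (Real.rpow_le_rpow h4 (hTq σ hσ).2.le ht.le)
            rw [hνW σ (hT.valid σ hσ)]
            exact mul_le_mul_of_nonneg_left (h _ (hlen σ hσ)) (hνpos σ (hT.valid σ hσ)).le
        _ = T.card * ε ^ t := by simp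
/-- in the multiscale Moran setting with `ω ∈ G(χ)`, let `s_{k,r}(ω)` solve
`Π_i (Σ_j (p_{ij} g_{ij}^r)^{s_{k,r}/(s_{k,r}+r)})^{N_{k,i}(ω)} = 1` and `s_r` the limiting
exponent.  (a) If `s_{k,r}(ω) ≥ s_r` for all large `k` then `Q̲_r^{s_r}(μ_ω) > 0`, and if in
addition `H̲_r(ω) = liminf_k k|s_{k,r}(ω) − s_r| = ∞` then `Q̄_r^{s_r}(μ_ω) = ∞`.
(b) If `s_{k,r}(ω) ≤ s_r` for all large `k` then `Q̄_r^{s_r}(μ_ω) < ∞`, and if in addition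
`H̲_r(ω) = ∞` then `Q̲_r^{s_r}(μ_ω) = 0`. -/
theorem quantCoeff_multiscale_moran_one_sided
    (d m : ℕ) (hm : 2 ≤ m)
    (N : Fin m → ℕ) (hN : ∀ i, 2 ≤ N i)
    (g : Fin m → ℕ → ℝ) (hg : ∀ i, ∀ j < N i, 0 < g i j ∧ g i j < 1)
    (p : Fin m → ℕ → ℝ) (hp : ∀ i, ∀ j < N i, 0 < p i j)
    (hp1 : ∀ i, ∑ j ∈ Finset.range (N i), p i j = 1)
    (χ : Fin m → ℝ) (hχ : ∀ i, 0 < χ i) (hχ1 : ∑ i, χ i = 1)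
    (ω : ℕ → Fin m)
    (hωG : ∀ i, Tendsto (fun k => (freqCount ω k i : ℝ) / (k : ℝ)) atTop (nhds (χ i)))
    (J : List ℕ → Set (EuclideanSpace ℝ (Fin d)))
    (hJ0 : IsCompact (J []) ∧ (J []).Nonempty ∧ J [] = closure (interior (J [])))
    (hJsub : ∀ σ : List ℕ, ValidWord N ω σ → ∀ j < N (ω σ.length), J (σ ++ [j]) ⊆ J σ)
    (hJsim : ∀ σ : List ℕ, ValidWord N ω σ → ∀ j < N (ω σ.length),
      ∃ S : EuclideanSpace ℝ (Fin d) → EuclideanSpace ℝ (Fin d),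
        (∀ x y, dist (S x) (S y) = g (ω σ.length) j * dist x y) ∧ S '' J σ = J (σ ++ [j]))
    (hsep : ∃ β : ℝ, 0 < β ∧ β < 1 ∧ ∀ σ : List ℕ, ValidWord N ω σ →
      ∀ j₁ j₂ : ℕ, j₁ < N (ω σ.length) → j₂ < N (ω σ.length) → j₁ ≠ j₂ →
      ∀ x ∈ J (σ ++ [j₁]), ∀ y ∈ J (σ ++ [j₂]),
        β * max (diam (J (σ ++ [j₁]))) (diam (J (σ ++ [j₂]))) ≤ dist x y)
    (μ : Measure (EuclideanSpace ℝ (Fin d))) [IsProbabilityMeasure μ]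
    (hμ : ∀ σ : List ℕ, ValidWord N ω σ →
      μ (J σ) = ENNReal.ofReal (∏ l : Fin σ.length, p (ω l) (σ.get l)))
    (r sr : ℝ) (hr : 0 < r) (hsr : 0 < sr)
    (hsreq : ∏ i, (∑ j ∈ Finset.range (N i), (p i j * g i j ^ r) ^ (sr / (sr + r))) ^ (χ i) = 1)
    (sk : ℕ → ℝ) (hsk : ∀ k, 0 < sk k)
    (hskeq : ∀ k, ∏ i, (∑ j ∈ Finset.range (N i),
      (p i j * g i j ^ r) ^ (sk k / (sk k + r))) ^ (freqCount ω k i : ℝ) = 1) :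
    ((∀ᶠ k in atTop, sr ≤ sk k) → 0 < lowerQuantCoeff μ r sr) ∧
    ((∀ᶠ k in atTop, sr ≤ sk k) →
      Tendsto (fun k : ℕ => (k : ℝ) * |sk k - sr|) atTop atTop →
      upperQuantCoeff μ r sr = ∞) ∧
    ((∀ᶠ k in atTop, sk k ≤ sr) → upperQuantCoeff μ r sr < ∞) ∧
    ((∀ᶠ k in atTop, sk k ≤ sr) →
      Tendsto (fun k : ℕ => (k : ℝ) * |sk k - sr|) atTop atTop →
      lowerQuantCoeff μ r sr = 0) := by
  obtain ⟨β, hβ, -, hsep⟩ := hsep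
  set q : Fin m → ℕ → ℝ := fun i j => p i j * g i j ^ r with hqdef
  have hqpos : ∀ i, ∀ j < N i, 0 < q i j := fun i j hj =>
    mul_pos (hp i j hj) (Real.rpow_pos_of_pos (hg i j hj).1 r)
  have hqlt : ∀ i, ∀ j < N i, 0 < 1 - q i j := by
    intro i j hj
    have h1 : p i j ≤ 1 := by
      rw [← hp1 i]
      exact Finset.single_le_sum (f := fun j => p i j)
        (fun j hj => (hp i j (Finset.mem_range.1 hj)).le) (Finset.mem_range.2 hj)
    have h2 : g i j ^ r < 1 := Real.rpow_lt_one (hg i j hj).1.le (hg i j hj).2 hr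
    have h3 : 0 < g i j ^ r := Real.rpow_pos_of_pos (hg i j hj).1 r
    have h4 := hp i j hj
    simp only [hqdef]
    nlinarith
  obtain ⟨η, hη, hηq⟩ := exists_pos_lower N q hqpos
  obtain ⟨δ, hδ, hδq⟩ := exists_pos_lower N (fun i j => 1 - q i j) hqlt
  set ρ : ℝ := 1 - δ with hρdef
  have hρ1 : ρ < 1 := by linarith
  have hq : ∀ i, ∀ j < N i, η ≤ q i j ∧ q i j ≤ ρ := fun i j hj =>
    ⟨hηq i j hj, by have := hδq i j hj; linarith⟩
  have hq' : ∀ i, ∀ j < N i, 0 < q i j ∧ q i j ≤ ρ := fun i j hj => ⟨hqpos i j hj, (hq i j hj).2⟩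
  have h00 : 0 < N (ω 0) := by have := hN (ω 0); omega
  have hρ0 : 0 < ρ := (hqpos _ _ h00).trans_le (hq _ _ h00).2
  have hη1 : η ≤ 1 := ((hq _ _ h00).1.trans (hq _ _ h00).2).trans hρ1.le
  set t : ℝ := sr / (sr + r) with htdef
  have ht : 0 < t := by positivity
  obtain ⟨D, hD, hcut⟩ := cut_main d m N hN g hg p hp hp1 ω J hJ0 hJsub hJsim β hβ hsep μ hμ r hr q
    hqdef η ρ hη hρ1 hq t ht
  have hμK : μ (J []) = 1 := by
    rw [hμ [] validWord_nil]; simp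
  set e : ℝ := (sr + r) / sr with hedef
  set e' : ℝ := (sr + r) / (sr * r) with hedef'
  have he : 0 < e := by positivity
  have he' : 0 < e' := by positivity
  have het : e * t = 1 := by rw [hedef, htdef]; field_simp
  have hsmall : ∀ K : ℝ, 0 < K → ∀ k0 : ℕ, ∀ᶠ n : ℕ in atTop,
      1 ≤ n ∧ (K / (n : ℝ)) ^ e ≤ η ^ k0 := by
    intro K hK k0
    have h1 : Tendsto (fun n : ℕ => (K / (n : ℝ)) ^ e) atTop (nhds 0) := by
      have h2 : Tendsto (fun n : ℕ => K / (n : ℝ)) atTop (nhds 0) :=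
        tendsto_const_div_atTop_nhds_zero_nat K
      have := h2.rpow_const (p := e) (Or.inr he.le)
      rwa [Real.zero_rpow he.ne'] at this
    filter_upwards [eventually_ge_atTop 1, h1.eventually_le_const (pow_pos hη k0)] with n h3 h4
    exact ⟨h3, h4⟩
  have upperCore : ∀ M : ℝ, 0 < M → (∀ᶠ k in atTop, levelSum N ω q t k ≤ M) →
      ∀ᶠ n : ℕ in atTop, (n : ℝ) ^ (1 / sr) * quantError μ r n ≤
        D ^ (1 / r) * (M / η ^ t) ^ e' := by
    intro M hM h
    obtain ⟨k0, hk0⟩ := eventually_atTop.1 h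
    have hηt : 0 < η ^ t := Real.rpow_pos_of_pos hη t
    have hK : 0 < M / η ^ t := by positivity
    filter_upwards [hsmall _ hK k0] with n hn
    obtain ⟨hn1, hnε⟩ := hn
    have hn0 : (0 : ℝ) < n := by exact_mod_cast hn1
    set K := M / η ^ t with hKdef
    set ε : ℝ := (K / (n : ℝ)) ^ e with hεdef
    have hε : 0 < ε := by positivity
    obtain ⟨T, hTc, hTn, hTd, hTs, hTsum, hTm, hTk⟩ :=
      hcut ε hε (hnε.trans (pow_le_one₀ hη.le hη1))
    have h1 := (hTk M k0 hnε).1 hk0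
    have hεt : ε ^ t = K / n := by
      rw [hεdef, ← Real.rpow_mul (by positivity), het, Real.rpow_one]
    have hcard' : (T.card : ℝ) ≤ n := by
      rw [Real.mul_rpow hη.le hε.le, hεt] at h1
      have h2 : η ^ t * (K / n) = M / n := by rw [hKdef]; field_simp
      rw [h2, mul_div_assoc', div_le_iff₀ hn0, mul_comm] at h1
      exact le_of_mul_le_mul_left h1 hM
    have hcard : T.card ≤ n := by exact_mod_cast hcard'
    have h2 : ∑ σ ∈ T, μ.real (J σ) * diam (J σ) ^ r ≤ n * (D * ε) := by
      calc ∑ σ ∈ T, μ.real (J σ) * diam (J σ) ^ r ≤ ∑ σ ∈ T, D * ε :=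
            Finset.sum_le_sum fun σ hσ => (hTm σ hσ).2
        _ = T.card * (D * ε) := by simp
        _ ≤ _ := by gcongr
    have h3 := quantError_le μ hJ0.1 hμK hr J T hTc hTn hTd hTsum n hcard _ h2
    have h4 := alg_exp hn0 hK hr hsr
    have h5 : (n * (D * ε)) ^ (1 / r) = D ^ (1 / r) * (n * ε) ^ (1 / r) := by
      rw [← Real.mul_rpow hD.le (by positivity)]; ring_nf
    rw [h5] at h3
    calc (n : ℝ) ^ (1 / sr) * quantError μ r n
        ≤ (n : ℝ) ^ (1 / sr) * (D ^ (1 / r) * (n * ε) ^ (1 / r)) := by gcongr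
      _ = D ^ (1 / r) * ((n : ℝ) ^ (1 / sr) * (n * ε) ^ (1 / r)) := by ring
      _ = _ := by rw [h4]
  have lowerCore : ∀ M : ℝ, 0 < M → (∀ᶠ k in atTop, M ≤ levelSum N ω q t k) →
      ∀ᶠ n : ℕ in atTop, ((β / 2) ^ r * (D * η)) ^ (1 / r) * (M / 2) ^ e' ≤
        (n : ℝ) ^ (1 / sr) * quantError μ r n := by
    intro M hM h
    obtain ⟨k0, hk0⟩ := eventually_atTop.1 h
    have hK : 0 < M / 2 := by positivity
    filter_upwards [hsmall _ hK k0] with n hn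
    obtain ⟨hn1, hnε⟩ := hn
    have hn0 : (0 : ℝ) < n := by exact_mod_cast hn1
    set K := M / 2 with hKdef
    set ε : ℝ := (K / (n : ℝ)) ^ e with hεdef
    have hε : 0 < ε := by positivity
    obtain ⟨T, hTc, hTn, hTd, hTs, hTsum, hTm, hTk⟩ :=
      hcut ε hε (hnε.trans (pow_le_one₀ hη.le hη1))
    have h1 := (hTk M k0 hnε).2 hk0
    have hεt : ε ^ t = K / n := by
      rw [hεdef, ← Real.rpow_mul (by positivity), het, Real.rpow_one]
    have hcard' : 2 * (n : ℝ) ≤ T.card := by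
      rw [hεt, mul_div_assoc', le_div_iff₀ hn0] at h1
      nlinarith
    have hcard : 2 * n ≤ T.card := by exact_mod_cast hcard'
    have h3 := le_quantError μ hJ0.1 hμK hr J T β hβ hTc hJ0.2.1 hTd hTs n hn1 hcard (D * (η * ε))
      (by positivity) (fun σ hσ => (hTm σ hσ).1)
    have h4 := alg_exp hn0 hK hr hsr
    set c := (β / 2) ^ r * (D * η) with hc
    have hc0 : 0 < c := by positivity
    have h5 : (n * ((β / 2) ^ r * (D * (η * ε)))) ^ (1 / r) =
        c ^ (1 / r) * (n * ε) ^ (1 / r) := by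
      rw [← Real.mul_rpow hc0.le (by positivity), hc]; ring_nf
    rw [h5] at h3
    calc c ^ (1 / r) * K ^ e'
        = c ^ (1 / r) * ((n : ℝ) ^ (1 / sr) * (n * ε) ^ (1 / r)) := by rw [h4]
      _ = (n : ℝ) ^ (1 / sr) * (c ^ (1 / r) * (n * ε) ^ (1 / r)) := by ring
      _ ≤ (n : ℝ) ^ (1 / sr) * quantError μ r n := by gcongr
  have hone : ∀ k, levelSum N ω q (sk k / (sk k + r)) k = 1 := by
    intro k
    rw [levelSum_eq]
    exact hskeq k
  have htk : ∀ k, sk k / (sk k + r) - t = r * (sk k - sr) / ((sk k + r) * (sr + r)) := by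
    intro k
    have := hsk k
    rw [htdef]
    field_simp
    ring
  have hlow : ∀ k, sr ≤ sk k →
      1 ≤ ρ ^ (k * (sk k / (sk k + r) - t)) * levelSum N ω q t k := by
    intro k hk
    have h1 : t ≤ sk k / (sk k + r) := by
      have h2 := htk k
      have h3 : 0 ≤ r * (sk k - sr) / ((sk k + r) * (sr + r)) := by
        have := hsk k
        have : 0 ≤ sk k - sr := by linarith
        positivity
      linarith
    have := levelSum_le N ω q ρ hq' hρ0 h1 k
    rwa [hone] at this
  have hupp : ∀ k, sk k ≤ sr →
      levelSum N ω q t k ≤ ρ ^ (k * (t - sk k / (sk k + r))) := by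
    intro k hk
    have h1 : sk k / (sk k + r) ≤ t := by
      have h2 := htk k
      have h3 : 0 ≤ r * (sr - sk k) / ((sk k + r) * (sr + r)) := by
        have := hsk k
        have : 0 ≤ sr - sk k := by linarith
        positivity
      have h4 : r * (sk k - sr) / ((sk k + r) * (sr + r)) =
        - (r * (sr - sk k) / ((sk k + r) * (sr + r))) := by ring
      linarith
    have := levelSum_le N ω q ρ hq' hρ0 h1 k
    rwa [hone, mul_one] at this
  have hρlim : Tendsto (fun x : ℝ => ρ ^ x) atTop (nhds 0) :=
    tendsto_rpow_atTop_of_base_lt_one ρ (by linarith) hρ1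
  have hlevpos : ∀ k, 0 ≤ levelSum N ω q t k := by
    intro k
    exact Finset.prod_nonneg fun l _ => Finset.sum_nonneg fun j hj =>
      Real.rpow_nonneg (hqpos _ j (Finset.mem_range.1 hj)).le _
  have hc0 : 0 < ((β / 2) ^ r * (D * η)) ^ (1 / r) := by positivity
  have hlowerQ : ∀ M : ℝ, 0 < M → (∀ᶠ k in atTop, M ≤ levelSum N ω q t k) →
      ENNReal.ofReal (((β / 2) ^ r * (D * η)) ^ (1 / r) * (M / 2) ^ e') ≤
        lowerQuantCoeff μ r sr := by
    intro M hM h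
    refine le_liminf_of_le (by isBoundedDefault) ?_
    filter_upwards [lowerCore M hM h] with n hn
    exact ENNReal.ofReal_le_ofReal hn
  have hupperQ : ∀ M : ℝ, 0 < M → (∀ᶠ k in atTop, levelSum N ω q t k ≤ M) →
      upperQuantCoeff μ r sr ≤ ENNReal.ofReal (D ^ (1 / r) * (M / η ^ t) ^ e') := by
    intro M hM h
    refine limsup_le_of_le (by isBoundedDefault) ?_
    filter_upwards [upperCore M hM h] with n hn
    exact ENNReal.ofReal_le_ofReal hn
  have hlu : lowerQuantCoeff μ r sr ≤ upperQuantCoeff μ r sr := liminf_le_limsup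
  refine ⟨?_, ?_, ?_, ?_⟩
  · intro h
    refine lt_of_lt_of_le ?_ (hlowerQ 1 one_pos ?_)
    · rw [ENNReal.ofReal_pos]; positivity
    · filter_upwards [h] with k hk
      have h1 := hlow k hk
      have h2 : ρ ^ (k * (sk k / (sk k + r) - t)) ≤ 1 := by
        refine Real.rpow_le_one hρ0.le hρ1.le ?_
        rw [htk]
        have := hsk k
        have : 0 ≤ sk k - sr := by linarith
        positivity
      have := hlevpos k
      nlinarith
  · intro h hH
    have hlim : Tendsto (fun k : ℕ => (k : ℝ) * (sk k / (sk k + r) - t)) atTop atTop := by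
      have h1 : Tendsto (fun k : ℕ => r / ((1 + sr + r) * (sr + r)) *
          min ((k : ℝ) * |sk k - sr|) (k : ℝ)) atTop atTop := by
        refine Tendsto.const_mul_atTop (by positivity) ?_
        refine tendsto_atTop.2 fun b => ?_
        filter_upwards [tendsto_atTop.1 hH b,
          tendsto_atTop.1 (tendsto_natCast_atTop_atTop (R := ℝ)) b] with k h1 h2
        exact le_min h1 h2
      refine tendsto_atTop_mono' _ ?_ h1
      filter_upwards [h] with k hk
      have hx : 0 ≤ sk k - sr := by linarith
      rw [abs_of_nonneg hx, htk]
      have hk0 : (0 : ℝ) ≤ k := Nat.cast_nonneg k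
      set x := sk k - sr with hxdef
      have hskx : sk k = x + sr := by linarith
      rw [hskx]
      have key : min (k * x) (k : ℝ) / (1 + sr + r) ≤ k * (x / (x + sr + r)) := by
        rw [mul_div_assoc', div_le_div_iff₀ (by positivity) (by positivity)]
        rcases le_total x 1 with hx1 | hx1
        · have h3 : min (k * x) (k : ℝ) ≤ k * x := min_le_left _ _
          have h4 : (0 : ℝ) ≤ k * x := by positivity
          calc min (k * x) (k : ℝ) * (x + sr + r) ≤ (k * x) * (x + sr + r) := by gcongr
            _ ≤ (k * x) * (1 + sr + r) := by gcongr
        · have h3 : min (k * x) (k : ℝ) ≤ k := min_le_right _ _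
          calc min (k * x) (k : ℝ) * (x + sr + r) ≤ k * (x + sr + r) := by gcongr
            _ ≤ k * (x * (1 + sr + r)) := by
                gcongr
                nlinarith
            _ = _ := by ring
      calc r / ((1 + sr + r) * (sr + r)) * min (k * x) (k : ℝ)
          = r / (sr + r) * (min (k * x) (k : ℝ) / (1 + sr + r)) := by
            field_simp
        _ ≤ r / (sr + r) * (k * (x / (x + sr + r))) := by gcongr
        _ = _ := by field_simp
    have hz := hρlim.comp hlim
    have hlow' : lowerQuantCoeff μ r sr = ∞ := by
      refine ENNReal.eq_top_of_forall_nnreal_le fun b => ?_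
      set c := ((β / 2) ^ r * (D * η)) ^ (1 / r) with hc
      have hb : (0 : ℝ) < (b + 1) / c := by positivity
      set M : ℝ := 2 * ((b + 1) / c) ^ (1 / e') with hM
      have hM0 : 0 < M := by positivity
      refine le_trans ?_ (hlowerQ M hM0 ?_)
      · have h1 : (M / 2) ^ e' = (b + 1) / c := by
          rw [hM, mul_div_cancel_left₀ _ two_ne_zero, ← Real.rpow_mul hb.le,
            one_div_mul_cancel he'.ne', Real.rpow_one]
        rw [h1, mul_div_cancel₀ _ hc0.ne']
        rw [← ENNReal.ofReal_coe_nnreal]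
        exact ENNReal.ofReal_le_ofReal (by linarith)
      · filter_upwards [h, hz.eventually_le_const (show (0 : ℝ) < M⁻¹ by positivity)] with k hk hk2
        have h1 := hlow k hk
        simp only [Function.comp] at hk2
        have h2 : 1 ≤ M⁻¹ * levelSum N ω q t k :=
          h1.trans (mul_le_mul_of_nonneg_right hk2 (hlevpos k))
        rwa [inv_mul_eq_div, le_div_iff₀ hM0, one_mul] at h2
    exact top_le_iff.1 (hlow' ▸ hlu)
  · intro h
    refine lt_of_le_of_lt (hupperQ 1 one_pos ?_) ENNReal.ofReal_lt_top
    filter_upwards [h] with k hk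
    refine (hupp k hk).trans (Real.rpow_le_one hρ0.le hρ1.le ?_)
    have h2 : t - sk k / (sk k + r) = r * (sr - sk k) / ((sk k + r) * (sr + r)) := by
      rw [← neg_sub, htk]; ring
    rw [h2]
    have := hsk k
    have : 0 ≤ sr - sk k := by linarith
    positivity
  · intro h hH
    have hlim : Tendsto (fun k : ℕ => (k : ℝ) * (t - sk k / (sk k + r))) atTop atTop := by
      have h1 : Tendsto (fun k : ℕ => r / ((sr + r) * (sr + r)) *
          ((k : ℝ) * |sk k - sr|)) atTop atTop :=
        Tendsto.const_mul_atTop (by positivity) hH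
      refine tendsto_atTop_mono' _ ?_ h1
      filter_upwards [h] with k hk
      have hx : 0 ≤ sr - sk k := by linarith
      have h2 : t - sk k / (sk k + r) = r * (sr - sk k) / ((sk k + r) * (sr + r)) := by
        rw [← neg_sub, htk]; ring
      rw [abs_sub_comm, abs_of_nonneg hx, h2]
      have := hsk k
      calc r / ((sr + r) * (sr + r)) * (k * (sr - sk k))
          = k * (r * (sr - sk k) / ((sr + r) * (sr + r))) := by ring
        _ ≤ _ := by gcongr
    have hz := hρlim.comp hlim
    have hzero : upperQuantCoeff μ r sr = 0 := by
      refine le_antisymm (ENNReal.le_of_forall_pos_le_add fun b hb _ => ?_) bot_le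
      rw [zero_add]
      set c := D ^ (1 / r) with hc
      have hcpos : 0 < c := by positivity
      have hbc : (0 : ℝ) < b / c := by positivity
      have hηt : 0 < η ^ t := Real.rpow_pos_of_pos hη t
      set M : ℝ := η ^ t * (b / c) ^ (1 / e') with hM
      have hM0 : 0 < M := by positivity
      refine (hupperQ M hM0 ?_).trans ?_
      · filter_upwards [h, hz.eventually_le_const hM0] with k hk hk2
        exact (hupp k hk).trans hk2
      · have h1 : (M / η ^ t) ^ e' = b / c := by
          rw [hM, mul_div_cancel_left₀ _ hηt.ne', ← Real.rpow_mul hbc.le,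
            one_div_mul_cancel he'.ne', Real.rpow_one]
        rw [h1, mul_div_cancel₀ _ hcpos.ne', ENNReal.ofReal_coe_nnreal]
    exact le_antisymm (hzero ▸ hlu) bot_le
end

section
/- Positive and finite quantization coefficients for multiscale Moran measures: In the multiscale Moran setting with ω ∈ G(χ), r ∈ (0,∞), let s_{k,r}(ω), s_r be as defined by Π_{i=1}^m (Σ_{j=1}^{N_i} (p_ij g_ij^r)^{s_{k,r}(ω)/(s_{k,r}(ω)+r)})^{N_{k,i}(ω)} = 1 and Π_{i=1}^m (Σ_{j=1}^{N_i} (p_ij g_ij^r)^{s_r/(s_r+r)})^{χ_i} = 1, and let H̄_r(ω) := limsup_{k→∞} k|s_{k,r}(ω) − s_r|. If H̄_r(ω) < ∞, then Q̲_r^{s_r}(μ_ω) and Q̄_r^{s_r}(μ_ω) are both positive and finite. In particular, this conclusion holds whenever ω ∈ G₀(χ), i.e. limsup_{k→∞} |N_{k,i}(ω) − kχ_i| < ∞ for each 1 ≤ i ≤ m. -/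
open MeasureTheory Filter Metric
open scoped ENNReal NNReal

namespace MoranAux

/-- product of letter weights along a word -/
noncomputable def prodW (f : ℕ → ℕ → ℝ) (σ : List ℕ) : ℝ :=
  ∏ l : Fin σ.length, f l (σ.get l)

lemma prodW_nil (f : ℕ → ℕ → ℝ) : prodW f [] = 1 := by
  simp [prodW]

lemma prodW_eq_range (f : ℕ → ℕ → ℝ) (σ : List ℕ) :
    prodW f σ = ∏ l ∈ Finset.range σ.length, f l (σ.getD l 0) := by
  rw [Finset.prod_range]
  unfold prodW
  refine Finset.prod_congr rfl fun l _ => ?_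
  simp

lemma prodW_append (f : ℕ → ℕ → ℝ) (σ : List ℕ) (j : ℕ) :
    prodW f (σ ++ [j]) = prodW f σ * f σ.length j := by
  rw [prodW_eq_range, prodW_eq_range, List.length_append, List.length_singleton,
    Finset.prod_range_succ]
  congr 1
  · refine Finset.prod_congr rfl fun l hl => ?_
    rw [List.getD_append _ _ _ _ (Finset.mem_range.1 hl)]
  · simp

lemma valid_nil {m : ℕ} (N : Fin m → ℕ) (ω : ℕ → Fin m) : ValidWord N ω [] := by
  intro l; exact l.elim0

lemma valid_append {m : ℕ} (N : Fin m → ℕ) (ω : ℕ → Fin m) (σ : List ℕ) (j : ℕ) :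
    ValidWord N ω (σ ++ [j]) ↔ ValidWord N ω σ ∧ j < N (ω σ.length) := by
  unfold ValidWord
  constructor
  · intro h
    constructor
    · intro l
      have := h ⟨l, by simp⟩
      simpa [List.getElem_append_left] using this
    · have := h ⟨σ.length, by simp⟩
      simpa using this
  · rintro ⟨h1, h2⟩ ⟨l, hl⟩
    rcases Nat.lt_or_ge l σ.length with h | h
    · have := h1 ⟨l, h⟩
      simpa [List.getElem_append_left, h] using this
    · have : l = σ.length := by simp at hl; omega
      subst this
      simpa using h2

/-- induction principle along valid words -/
lemma valid_induction {m : ℕ} {N : Fin m → ℕ} {ω : ℕ → Fin m} {P : List ℕ → Prop}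
    (h0 : P []) (hs : ∀ σ j, ValidWord N ω σ → j < N (ω σ.length) → P σ → P (σ ++ [j]))
    (σ : List ℕ) (hσ : ValidWord N ω σ) : P σ := by
  induction σ using List.reverseRecOn with
  | nil => exact h0
  | append_singleton σ j ih =>
    rw [valid_append] at hσ
    exact hs σ j hσ.1 hσ.2 (ih hσ.1)

lemma exists_lower {m : ℕ} (N : Fin m → ℕ) (f : Fin m → ℕ → ℝ)
    (hf : ∀ i, ∀ j < N i, 0 < f i j) : ∃ η : ℝ, 0 < η ∧ η ≤ 1 ∧ ∀ i, ∀ j < N i, η ≤ f i j := by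
  let S : Finset (Σ _ : Fin m, ℕ) := Finset.univ.sigma fun i => Finset.range (N i)
  rcases S.eq_empty_or_nonempty with h | h
  · refine ⟨1, one_pos, le_rfl, fun i j hj => ?_⟩
    have : (⟨i, j⟩ : Σ _ : Fin m, ℕ) ∈ S := by simp [S, hj]
    simp [h] at this
  · obtain ⟨x, hx, hmin⟩ := S.exists_min_image (fun x => f x.1 x.2) h
    have hx' : x.2 < N x.1 := by simpa [S] using hx
    refine ⟨min 1 (f x.1 x.2), lt_min one_pos (hf _ _ hx'), min_le_left _ _, fun i j hj => ?_⟩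
    exact (min_le_right _ _).trans (hmin ⟨i, j⟩ (by simp [S, hj]))

/-- existence of finite cuts -/
lemma exists_cut {E : Type*} [MetricSpace E] (V : List ℕ → Prop) (b : List ℕ → ℕ) (hV0 : V [])
    (hV : ∀ σ, V σ → ∀ j < b σ, V (σ ++ [j]))
    (J : List ℕ → Set E) (hJne : ∀ σ, V σ → (J σ).Nonempty)
    (hJb : ∀ σ, V σ → Bornology.IsBounded (J σ))
    (hJd : ∀ σ, V σ → 0 < diam (J σ))
    (hJsub : ∀ σ, V σ → ∀ j < b σ, J (σ ++ [j]) ⊆ J σ)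
    (β : ℝ) (hβ : 0 < β)
    (hsep : ∀ σ, V σ → ∀ j₁ j₂ : ℕ, j₁ < b σ → j₂ < b σ → j₁ ≠ j₂ →
      ∀ x ∈ J (σ ++ [j₁]), ∀ y ∈ J (σ ++ [j₂]),
        β * max (diam (J (σ ++ [j₁]))) (diam (J (σ ++ [j₂]))) ≤ dist x y)
    (h : List ℕ → ℝ) (h0 : h [] = 1) (η κ ε : ℝ) (hη0 : 0 < η) (hη : η ≤ 1) (hκ : 0 ≤ κ)
    (hε : ε ≤ 1) (hε0 : 0 < ε)
    (hh : ∀ σ, V σ → ∀ j < b σ, η * h σ ≤ h (σ ++ [j]) ∧ h (σ ++ [j]) ≤ κ * h σ) (k : ℕ) :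
    ∃ A : Finset (List ℕ),
      (∀ σ ∈ A, V σ ∧ η * ε ≤ h σ ∧ (h σ < ε ∨ h σ ≤ κ ^ k)) ∧
      (∀ σ ∈ A, ∀ τ ∈ A, σ ≠ τ → ∀ x ∈ J σ, ∀ y ∈ J τ,
        β * max (diam (J σ)) (diam (J τ)) ≤ dist x y) ∧
      (∀ w : List ℕ → ℝ, (∀ σ, V σ → ∑ j ∈ Finset.range (b σ), w (σ ++ [j]) = w σ) →
        ∑ σ ∈ A, w σ = w []) := by
  classical
  induction k with
  | zero =>
    refine ⟨{[]}, ?_, ?_, ?_⟩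
    · intro σ hσ
      rw [Finset.mem_singleton] at hσ
      subst hσ
      exact ⟨hV0, by rw [h0]; nlinarith, by simp [h0]⟩
    · intro σ hσ τ hτ hne
      rw [Finset.mem_singleton] at hσ hτ
      exact absurd (hσ.trans hτ.symm) hne
    · intro w _
      simp
  | succ k ih =>
    obtain ⟨A, hA1, hA2, hA3⟩ := ih
    let ch : List ℕ → Finset (List ℕ) := fun σ =>
      if h σ < ε then {σ} else (Finset.range (b σ)).image fun j => σ ++ [j]
    have hch : ∀ σ ∈ A, ∀ ρ ∈ ch σ, V ρ ∧ J ρ ⊆ J σ ∧ η * ε ≤ h ρ ∧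
        (h ρ < ε ∨ h ρ ≤ κ ^ (k+1)) := by
      intro σ hσ ρ hρ
      obtain ⟨hVσ, h1, h2⟩ := hA1 σ hσ
      by_cases hc : h σ < ε
      · simp only [ch, if_pos hc, Finset.mem_singleton] at hρ
        subst hρ
        exact ⟨hVσ, subset_rfl, h1, Or.inl hc⟩
      · simp only [ch, if_neg hc, Finset.mem_image, Finset.mem_range] at hρ
        obtain ⟨j, hj, rfl⟩ := hρ
        obtain ⟨h3, h4⟩ := hh σ hVσ j hj
        refine ⟨hV σ hVσ j hj, hJsub σ hVσ j hj, ?_, Or.inr ?_⟩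
        · push Not at hc
          exact (mul_le_mul_of_nonneg_left hc hη0.le).trans h3
        · have := h2.resolve_left hc
          rw [pow_succ']
          exact h4.trans (mul_le_mul_of_nonneg_left this hκ)
    have hdisj : Set.PairwiseDisjoint (↑A : Set (List ℕ)) ch := by
      intro σ hσ τ hτ hne
      rw [Function.onFun, Finset.disjoint_left]
      intro ρ h1 h2
      obtain ⟨hVρ, hs1, -⟩ := hch σ hσ ρ h1
      obtain ⟨-, hs2, -⟩ := hch τ hτ ρ h2
      obtain ⟨x, hx⟩ := hJne ρ hVρ
      have := hA2 σ hσ τ hτ hne x (hs1 hx) x (hs2 hx)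
      rw [dist_self] at this
      have hd : 0 < max (diam (J σ)) (diam (J τ)) := lt_max_of_lt_left (hJd σ (hA1 σ hσ).1)
      nlinarith [mul_pos hβ hd]
    refine ⟨A.biUnion ch, ?_, ?_, ?_⟩
    · intro ρ hρ
      obtain ⟨σ, hσ, hρ⟩ := Finset.mem_biUnion.1 hρ
      have := hch σ hσ ρ hρ
      exact ⟨this.1, this.2.2⟩
    · intro ρ₁ hρ₁ ρ₂ hρ₂ hne x hx y hy
      obtain ⟨σ, hσ, hρ₁⟩ := Finset.mem_biUnion.1 hρ₁
      obtain ⟨τ, hτ, hρ₂⟩ := Finset.mem_biUnion.1 hρ₂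
      by_cases hst : σ = τ
      · subst hst
        by_cases hc : h σ < ε
        · simp only [ch, if_pos hc, Finset.mem_singleton] at hρ₁ hρ₂
          exact absurd (hρ₁.trans hρ₂.symm) hne
        · simp only [ch, if_neg hc, Finset.mem_image, Finset.mem_range] at hρ₁ hρ₂
          obtain ⟨j, hj, rfl⟩ := hρ₁
          obtain ⟨j', hj', rfl⟩ := hρ₂
          exact hsep σ (hA1 σ hσ).1 j j' hj hj' (fun h => hne (by rw [h])) x hx y hy
      · obtain ⟨-, hs1, -⟩ := hch σ hσ ρ₁ hρ₁
        obtain ⟨-, hs2, -⟩ := hch τ hτ ρ₂ hρ₂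
        refine le_trans ?_ (hA2 σ hσ τ hτ hst x (hs1 hx) y (hs2 hy))
        refine mul_le_mul_of_nonneg_left (max_le_max ?_ ?_) hβ.le
        · exact diam_mono hs1 (hJb σ (hA1 σ hσ).1)
        · exact diam_mono hs2 (hJb τ (hA1 τ hτ).1)
    · intro w hw
      rw [Finset.sum_biUnion hdisj, ← hA3 w hw]
      refine Finset.sum_congr rfl fun σ hσ => ?_
      by_cases hc : h σ < ε
      · simp [ch, if_pos hc]
      · simp only [ch, if_neg hc]
        rw [Finset.sum_image, hw σ (hA1 σ hσ).1]
        intro a _ b _ hab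
        simpa using hab

section Quant
variable {d : ℕ}

lemma integrable_infDist (μ : Measure (EuclideanSpace ℝ (Fin d))) [IsProbabilityMeasure μ]
    (K : Set (EuclideanSpace ℝ (Fin d))) (hK : IsCompact K) (hμK : μ K = 1) (r : ℝ) (hr : 0 < r)
    (α : Finset (EuclideanSpace ℝ (Fin d))) :
    Integrable (fun x => infDist x (↑α : Set (EuclideanSpace ℝ (Fin d))) ^ r) μ := by
  have hc : Continuous (fun x => infDist x (↑α : Set (EuclideanSpace ℝ (Fin d))) ^ r) :=
    (continuous_infDist_pt _).rpow_const fun _ => Or.inr hr.le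
  obtain ⟨C, hC⟩ := hK.exists_bound_of_continuousOn hc.continuousOn
  refine Integrable.of_bound hc.aestronglyMeasurable C ?_
  have : ∀ᵐ x ∂μ, x ∈ K := by
    rw [← prob_compl_eq_zero_iff hK.measurableSet] at hμK
    exact hμK
  filter_upwards [this] with x hx using hC x hx

lemma quant_upper (μ : Measure (EuclideanSpace ℝ (Fin d))) [IsProbabilityMeasure μ]
    (K : Set (EuclideanSpace ℝ (Fin d))) (hK : IsCompact K) (hμK : μ K = 1) (r : ℝ) (hr : 0 < r)
    (A : Finset (List ℕ)) (n : ℕ) (hn : A.card ≤ n)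
    (J : List ℕ → Set (EuclideanSpace ℝ (Fin d)))
    (hJc : ∀ σ ∈ A, IsCompact (J σ)) (hJne : ∀ σ ∈ A, (J σ).Nonempty)
    (hdisj : Set.PairwiseDisjoint (↑A : Set (List ℕ)) J)
    (P : List ℕ → ℝ) (hP : ∀ σ ∈ A, 0 ≤ P σ) (hμP : ∀ σ ∈ A, μ (J σ) = ENNReal.ofReal (P σ))
    (hsum : ∑ σ ∈ A, P σ = 1) :
    quantError μ r n ≤ (∑ σ ∈ A, P σ * diam (J σ) ^ r) ^ (1 / r) := by
  classical
  choose! a ha using hJne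
  have hAne : A.Nonempty := by
    rw [Finset.nonempty_iff_ne_empty]; rintro rfl; simp at hsum
  let α : Finset (EuclideanSpace ℝ (Fin d)) := A.image a
  have hint := integrable_infDist μ K hK hμK r hr α
  have hbd : BddBelow {e : ℝ | ∃ α : Finset (EuclideanSpace ℝ (Fin d)), 1 ≤ α.card ∧ α.card ≤ n ∧
    e = (∫ x, infDist x (↑α : Set (EuclideanSpace ℝ (Fin d))) ^ r ∂μ) ^ (1 / r)} := by
    refine ⟨0, ?_⟩
    rintro e ⟨α, -, -, rfl⟩
    exact Real.rpow_nonneg (integral_nonneg fun x => Real.rpow_nonneg infDist_nonneg _) _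
  refine (csInf_le hbd ⟨α, ?_, ?_, rfl⟩).trans ?_
  · exact Finset.card_pos.2 (hAne.image _)
  · exact Finset.card_image_le.trans hn
  refine Real.rpow_le_rpow (integral_nonneg fun x => Real.rpow_nonneg infDist_nonneg _) ?_
    (by positivity)
  have hU : μ (⋃ σ ∈ A, J σ) = 1 := by
    rw [measure_biUnion_finset hdisj fun σ hσ => (hJc σ hσ).measurableSet,
      Finset.sum_congr rfl hμP, ← ENNReal.ofReal_sum_of_nonneg hP, hsum, ENNReal.ofReal_one]
  have hUm : MeasurableSet (⋃ σ ∈ A, J σ) :=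
    Finset.measurableSet_biUnion _ fun σ hσ => (hJc σ hσ).measurableSet
  have hae : ∀ᵐ x ∂μ, x ∈ ⋃ σ ∈ A, J σ := by
    rw [← prob_compl_eq_zero_iff hUm] at hU
    exact hU
  rw [← setIntegral_univ, setIntegral_congr_set (t := ⋃ σ ∈ A, J σ)
    (by filter_upwards [hae] with x hx; exact propext ⟨fun _ => hx, fun _ => trivial⟩),
    integral_biUnion_finset A (fun σ hσ => (hJc σ hσ).measurableSet) hdisj
    (fun σ _ => hint.integrableOn)]
  refine Finset.sum_le_sum fun σ hσ => ?_
  have hreal : μ.real (J σ) = P σ := by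
    rw [measureReal_def, hμP σ hσ, ENNReal.toReal_ofReal (hP σ hσ)]
  calc ∫ x in J σ, infDist x (↑α : Set (EuclideanSpace ℝ (Fin d))) ^ r ∂μ
      ≤ ∫ x in J σ, diam (J σ) ^ r ∂μ := by
        refine setIntegral_mono_on hint.integrableOn (integrableOn_const (measure_ne_top _ _))
          (hJc σ hσ).measurableSet fun x hx => ?_
        refine Real.rpow_le_rpow infDist_nonneg ?_ hr.le
        have : a σ ∈ (↑α : Set (EuclideanSpace ℝ (Fin d))) := by
          simp only [α, Finset.coe_image]; exact ⟨σ, hσ, rfl⟩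
        exact (infDist_le_dist_of_mem this).trans
          (dist_le_diam_of_mem (hJc σ hσ).isBounded hx (ha σ hσ))
    _ = P σ * diam (J σ) ^ r := by
        rw [setIntegral_const, hreal, smul_eq_mul]

lemma quant_lower (μ : Measure (EuclideanSpace ℝ (Fin d))) [IsProbabilityMeasure μ]
    (K : Set (EuclideanSpace ℝ (Fin d))) (hK : IsCompact K) (hμK : μ K = 1) (r : ℝ) (hr : 0 < r)
    (A : Finset (List ℕ)) (n : ℕ) (hn1 : 1 ≤ n) (hn : 2 * n ≤ A.card)
    (J : List ℕ → Set (EuclideanSpace ℝ (Fin d)))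
    (hJc : ∀ σ ∈ A, IsCompact (J σ))
    (hJd : ∀ σ ∈ A, 0 < diam (J σ)) (β : ℝ) (hβ : 0 < β)
    (hsep : ∀ σ ∈ A, ∀ τ ∈ A, σ ≠ τ → ∀ x ∈ J σ, ∀ y ∈ J τ,
        β * max (diam (J σ)) (diam (J τ)) ≤ dist x y)
    (P : List ℕ → ℝ) (hP : ∀ σ ∈ A, 0 ≤ P σ) (hμP : ∀ σ ∈ A, μ (J σ) = ENNReal.ofReal (P σ))
    (q : ℝ) (hq : 0 ≤ q) (hPq : ∀ σ ∈ A, q ≤ P σ * diam (J σ) ^ r) :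
    (n * (q * (β / 2) ^ r)) ^ (1 / r) ≤ quantError μ r n := by
  classical
  refine le_csInf ⟨_, {0}, by simp, by simpa using hn1, rfl⟩ ?_
  rintro e ⟨α, hα1, hα2, rfl⟩
  have hint := integrable_infDist μ K hK hμK r hr α
  refine Real.rpow_le_rpow (by positivity) ?_ (by positivity)
  -- near sets
  let near : EuclideanSpace ℝ (Fin d) → List ℕ → Prop := fun a σ =>
    ∃ x ∈ J σ, dist x a < β / 2 * diam (J σ)
  have huniq : ∀ a, ∀ σ ∈ A, ∀ τ ∈ A, near a σ → near a τ → σ = τ := by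
    rintro a σ hσ τ hτ ⟨x, hx, hxa⟩ ⟨y, hy, hya⟩
    by_contra hne
    have h1 := hsep σ hσ τ hτ hne x hx y hy
    have h2 := dist_triangle_right x y a
    have h3 : β * diam (J σ) ≤ β * max (diam (J σ)) (diam (J τ)) :=
      mul_le_mul_of_nonneg_left (le_max_left _ _) hβ.le
    have h4 : β * diam (J τ) ≤ β * max (diam (J σ)) (diam (J τ)) :=
      mul_le_mul_of_nonneg_left (le_max_right _ _) hβ.le
    linarith
  let B := A.filter fun σ => ∀ a ∈ α, ¬ near a σ
  let B' := A.filter fun σ => ¬ ∀ a ∈ α, ¬ near a σ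
  have hBcard : B.card + B'.card = A.card := Finset.card_filter_add_card_filter_not _
  have hB' : B'.card ≤ α.card := by
    have : ∀ σ ∈ B', ∃ a ∈ α, near a σ := by
      intro σ hσ
      have := (Finset.mem_filter.1 hσ).2
      push Not at this
      exact this
    choose! f hf using this
    refine Finset.card_le_card_of_injOn f (fun σ hσ => (hf σ hσ).1) ?_
    intro σ hσ τ hτ hst
    refine huniq (f σ) σ (Finset.mem_filter.1 hσ).1 τ (Finset.mem_filter.1 hτ).1
      (hf σ hσ).2 ?_
    rw [hst]; exact (hf τ hτ).2
  have hBn : n ≤ B.card := by omega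
  have hBA : ∀ σ ∈ B, σ ∈ A := fun σ hσ => (Finset.mem_filter.1 hσ).1
  have hdisj : Set.PairwiseDisjoint (↑B : Set (List ℕ)) J := by
    intro σ hσ τ hτ hne
    rw [Function.onFun, Set.disjoint_left]
    intro x hx hx'
    have := hsep σ (hBA σ hσ) τ (hBA τ hτ) hne x hx x hx'
    rw [dist_self] at this
    have hd : 0 < max (diam (J σ)) (diam (J τ)) := lt_max_of_lt_left (hJd σ (hBA σ hσ))
    nlinarith [mul_pos hβ hd]
  have hαne : (↑α : Set (EuclideanSpace ℝ (Fin d))).Nonempty := by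
    rw [Finset.coe_nonempty]; exact Finset.card_pos.1 hα1
  calc (n : ℝ) * (q * (β / 2) ^ r) ≤ B.card * (q * (β / 2) ^ r) := by
        gcongr
    _ = ∑ σ ∈ B, q * (β / 2) ^ r := by simp
    _ ≤ ∑ σ ∈ B, ∫ x in J σ, infDist x (↑α : Set (EuclideanSpace ℝ (Fin d))) ^ r ∂μ := by
        refine Finset.sum_le_sum fun σ hσ => ?_
        have hσA := hBA σ hσ
        have hreal : μ.real (J σ) = P σ := by
          rw [measureReal_def, hμP σ hσA, ENNReal.toReal_ofReal (hP σ hσA)]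
        calc q * (β / 2) ^ r ≤ (P σ * diam (J σ) ^ r) * (β / 2) ^ r := by
              gcongr; exact hPq σ hσA
          _ = ∫ x in J σ, (β / 2 * diam (J σ)) ^ r ∂μ := by
              rw [setIntegral_const, hreal, smul_eq_mul,
                Real.mul_rpow (by positivity) diam_nonneg]
              ring
          _ ≤ _ := by
              refine setIntegral_mono_on (integrableOn_const (measure_ne_top _ _))
                hint.integrableOn (hJc σ hσA).measurableSet fun x hx => ?_
              refine Real.rpow_le_rpow (by have := hJd σ hσA; positivity) ?_ hr.le
              refine (le_infDist hαne).2 fun {a} ha => ?_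
              by_contra hlt
              push Not at hlt
              exact (Finset.mem_filter.1 hσ).2 a ha ⟨x, hx, hlt⟩
    _ = ∫ x in ⋃ σ ∈ B, J σ, infDist x (↑α : Set (EuclideanSpace ℝ (Fin d))) ^ r ∂μ := by
        rw [integral_biUnion_finset B (fun σ hσ => (hJc σ (hBA σ hσ)).measurableSet) hdisj
          (fun σ _ => hint.integrableOn)]
    _ ≤ _ := setIntegral_le_integral hint
        (Eventually.of_forall fun x => Real.rpow_nonneg infDist_nonneg _)

end Quant

lemma rpow_combine (n x r s : ℝ) (hn : 0 < n) (hx : 0 ≤ x) (hr : 0 < r) (hs : 0 < s) :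
    n ^ (1 / s) * (n * x) ^ (1 / r) = (n ^ (1 + r / s) * x) ^ (1 / r) := by
  rw [Real.rpow_add hn, Real.rpow_one, Real.mul_rpow hn.le hx,
    Real.mul_rpow (by positivity) hx, Real.mul_rpow hn.le (by positivity),
    ← Real.rpow_mul hn.le (r / s)]
  have : r / s * (1 / r) = 1 / s := by field_simp
  rw [this]; ring

lemma coeff_of_bounds {E : Type*} [MetricSpace E] [MeasurableSpace E] (μ : Measure E) (r s : ℝ)
    (c C : ℝ) (hc : 0 < c)
    (h1 : ∀ᶠ n : ℕ in atTop, c ≤ (n : ℝ) ^ (1 / s) * quantError μ r n)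
    (h2 : ∀ᶠ n : ℕ in atTop, (n : ℝ) ^ (1 / s) * quantError μ r n ≤ C) :
    0 < lowerQuantCoeff μ r s ∧ lowerQuantCoeff μ r s ≤ upperQuantCoeff μ r s ∧
        upperQuantCoeff μ r s < ∞ := by
  refine ⟨?_, liminf_le_limsup, ?_⟩
  · refine lt_of_lt_of_le (ENNReal.ofReal_pos.2 hc) ?_
    refine le_liminf_of_le (by isBoundedDefault) ?_
    filter_upwards [h1] with n hn using ENNReal.ofReal_le_ofReal hn
  · refine lt_of_le_of_lt ?_ (ENNReal.ofReal_lt_top (r := C))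
    refine limsup_le_of_le (by isBoundedDefault) ?_
    filter_upwards [h2] with n hn using ENNReal.ofReal_le_ofReal hn

lemma core
    (d m : ℕ)
    (N : Fin m → ℕ) (hN : ∀ i, 2 ≤ N i)
    (g : Fin m → ℕ → ℝ) (hg : ∀ i, ∀ j < N i, 0 < g i j ∧ g i j < 1)
    (p : Fin m → ℕ → ℝ) (hp : ∀ i, ∀ j < N i, 0 < p i j)
    (hp1 : ∀ i, ∑ j ∈ Finset.range (N i), p i j = 1)
    (ω : ℕ → Fin m)
    (J : List ℕ → Set (EuclideanSpace ℝ (Fin d)))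
    (hJ0 : IsCompact (J []) ∧ (J []).Nonempty ∧ J [] = closure (interior (J [])))
    (hJsub : ∀ σ : List ℕ, ValidWord N ω σ → ∀ j < N (ω σ.length), J (σ ++ [j]) ⊆ J σ)
    (hJsim : ∀ σ : List ℕ, ValidWord N ω σ → ∀ j < N (ω σ.length),
      ∃ S : EuclideanSpace ℝ (Fin d) → EuclideanSpace ℝ (Fin d),
        (∀ x y, dist (S x) (S y) = g (ω σ.length) j * dist x y) ∧ S '' J σ = J (σ ++ [j]))
    (hsep : ∃ β : ℝ, 0 < β ∧ β < 1 ∧ ∀ σ : List ℕ, ValidWord N ω σ →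
      ∀ j₁ j₂ : ℕ, j₁ < N (ω σ.length) → j₂ < N (ω σ.length) → j₁ ≠ j₂ →
      ∀ x ∈ J (σ ++ [j₁]), ∀ y ∈ J (σ ++ [j₂]),
        β * max (diam (J (σ ++ [j₁]))) (diam (J (σ ++ [j₂]))) ≤ dist x y)
    (μ : Measure (EuclideanSpace ℝ (Fin d))) [IsProbabilityMeasure μ]
    (hμ : ∀ σ : List ℕ, ValidWord N ω σ →
      μ (J σ) = ENNReal.ofReal (∏ l : Fin σ.length, p (ω l) (σ.get l)))
    (r sr : ℝ) (hr : 0 < r) (hsr : 0 < sr)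
    (M : ℝ)
    (hM : ∀ k, |∑ l ∈ Finset.range k, Real.log (∑ j ∈ Finset.range (N (ω l)),
      (p (ω l) j * g (ω l) j ^ r) ^ (sr / (sr + r)))| ≤ M) :
    0 < lowerQuantCoeff μ r sr ∧ lowerQuantCoeff μ r sr ≤ upperQuantCoeff μ r sr ∧
        upperQuantCoeff μ r sr < ∞ := by
  obtain ⟨β, hβ, hβ1, hsep⟩ := hsep
  set t := sr / (sr + r) with ht
  have ht0 : 0 < t := by positivity
  have htinv : t * (1 + r / sr) = 1 := by rw [ht]; field_simp
  set τ := 1 + r / sr with hτ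
  have hτ0 : 0 < τ := by positivity
  set a : Fin m → ℕ → ℝ := fun i j => p i j * g i j ^ r with ha
  have hple : ∀ i, ∀ j < N i, p i j ≤ 1 := by
    intro i j hj
    rw [← hp1 i]
    exact Finset.single_le_sum (f := fun j => p i j) (fun j hj => (hp i j (Finset.mem_range.1 hj)).le)
      (Finset.mem_range.2 hj)
  have ha0 : ∀ i, ∀ j < N i, 0 < a i j := fun i j hj =>
    mul_pos (hp i j hj) (Real.rpow_pos_of_pos (hg i j hj).1 _)
  have ha1 : ∀ i, ∀ j < N i, 0 < 1 - a i j := by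
    intro i j hj
    have h1 : g i j ^ r < 1 := Real.rpow_lt_one (hg i j hj).1.le (hg i j hj).2 hr
    have h2 := hple i j hj
    have h3 := hp i j hj
    simp only [ha]
    nlinarith
  obtain ⟨η, hη0, hη1, hη⟩ := exists_lower N a ha0
  obtain ⟨κ', hκ0', hκ1', hκ'⟩ := exists_lower N (fun i j => 1 - a i j) ha1
  set F : Fin m → ℝ := fun i => ∑ j ∈ Finset.range (N i), (a i j) ^ t with hF
  have hF0 : ∀ i, 0 < F i := fun i =>
    Finset.sum_pos (fun j hj => Real.rpow_pos_of_pos (ha0 i j (Finset.mem_range.1 hj)) _)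
      ⟨0, Finset.mem_range.2 (by have := hN i; omega)⟩
  set V := ValidWord N ω with hVdef
  set b : List ℕ → ℕ := fun σ => N (ω σ.length) with hb
  -- weights
  set P := prodW (fun l j => p (ω l) j) with hPdef
  set G := prodW (fun l j => g (ω l) j) with hGdef
  set h := prodW (fun l j => a (ω l) j) with hhdef
  set ν := prodW (fun l j => a (ω l) j ^ t / F (ω l)) with hνdef
  set D := diam (J []) with hD
  have hV : ∀ σ, V σ → ∀ j < b σ, V (σ ++ [j]) := fun σ hσ j hj =>
    (valid_append N ω σ j).2 ⟨hσ, hj⟩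
  have hP0 : ∀ σ, V σ → 0 < P σ := by
    intro σ hσ
    refine valid_induction (P := fun σ => 0 < P σ) ?_ ?_ σ hσ
    · simp [hPdef, prodW_nil]
    · intro σ j hσ hj h
      simp only [hPdef, prodW_append] at h ⊢
      exact mul_pos h (hp _ _ hj)
  have hG0 : ∀ σ, V σ → 0 < G σ := by
    intro σ hσ
    refine valid_induction (P := fun σ => 0 < G σ) ?_ ?_ σ hσ
    · simp [hGdef, prodW_nil]
    · intro σ j hσ hj h
      simp only [hGdef, prodW_append] at h ⊢
      exact mul_pos h (hg _ _ hj).1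
  have hh0 : ∀ σ, V σ → 0 < h σ := by
    intro σ hσ
    refine valid_induction (P := fun σ => 0 < h σ) ?_ ?_ σ hσ
    · simp [hhdef, prodW_nil]
    · intro σ j hσ hj h
      simp only [hhdef, prodW_append] at h ⊢
      exact mul_pos h (ha0 _ _ hj)
  have hhPG : ∀ σ, V σ → h σ = P σ * G σ ^ r := by
    intro σ hσ
    refine valid_induction (N := N) (ω := ω) (P := fun σ => V σ ∧ h σ = P σ * G σ ^ r) ?_ ?_ σ hσ |>.2
    · exact ⟨valid_nil N ω, by simp [hhdef, hPdef, hGdef, prodW_nil]⟩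
    · rintro σ j hσ hj ⟨-, h⟩
      refine ⟨hV σ hσ j hj, ?_⟩
      have hG := (hG0 σ hσ).le
      simp only [hhdef, hPdef, hGdef, prodW_append] at h hG ⊢
      rw [h, Real.mul_rpow hG (hg _ _ hj).1.le]
      simp only [ha]
      ring
  have hJall : ∀ σ, V σ → IsCompact (J σ) ∧ (J σ).Nonempty ∧ diam (J σ) = G σ * D := by
    intro σ hσ
    refine valid_induction (N := N) (ω := ω)
      (P := fun σ => IsCompact (J σ) ∧ (J σ).Nonempty ∧ diam (J σ) = G σ * D) ?_ ?_ σ hσ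
    · exact ⟨hJ0.1, hJ0.2.1, by simp [hGdef, prodW_nil, hD]⟩
    · rintro σ j hσ hj ⟨h1, h2, h3⟩
      obtain ⟨S, hS, hSJ⟩ := hJsim σ hσ j hj
      have hg0 := (hg _ _ hj).1
      have hLip : LipschitzWith (g (ω σ.length) j).toNNReal S :=
        LipschitzWith.of_dist_le_mul fun x y => by
          rw [hS, Real.coe_toNNReal _ hg0.le]
      rw [← hSJ]
      refine ⟨h1.image hLip.continuous, h2.image S, ?_⟩
      have hbd := (h1.image hLip.continuous).isBounded
      have : diam (S '' J σ) = g (ω σ.length) j * diam (J σ) := by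
        apply le_antisymm
        · refine diam_le_of_forall_dist_le (mul_nonneg hg0.le diam_nonneg) ?_
          rintro _ ⟨x, hx, rfl⟩ _ ⟨y, hy, rfl⟩
          rw [hS]
          exact mul_le_mul_of_nonneg_left (dist_le_diam_of_mem h1.isBounded hx hy) hg0.le
        · rw [← le_div_iff₀' hg0]
          refine diam_le_of_forall_dist_le (div_nonneg diam_nonneg hg0.le) fun x hx y hy => ?_
          rw [le_div_iff₀' hg0, ← hS]
          exact dist_le_diam_of_mem hbd ⟨x, hx, rfl⟩ ⟨y, hy, rfl⟩
      rw [this, h3]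
      simp only [hGdef, prodW_append]
      ring
  have hV0 : V [] := valid_nil N ω
  -- positive diameter
  have hD0 : 0 < D := by
    rcases (diam_nonneg (s := J [])).lt_or_eq with h | h
    · exact h
    · exfalso
      have hj : (0 : ℕ) < b [] := by have := hN (ω 0); simp [hb]; omega
      have hne := (hJall _ (hV [] hV0 0 hj)).2.1
      have hEq : J ([] ++ [0]) = J [] := by
        refine (hJsub [] hV0 0 hj).antisymm ?_
        obtain ⟨y, hy⟩ := hne
        intro x hx
        have := dist_le_diam_of_mem hJ0.1.isBounded hx (hJsub [] hV0 0 hj hy)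
        rw [← h] at this
        rw [dist_le_zero.1 this]; exact hy
      have h1 := hμ _ (hV [] hV0 0 hj)
      have h2 := hμ [] hV0
      rw [hEq, h2] at h1
      simp only [List.nil_append, List.length_nil, Finset.univ_eq_empty, Finset.prod_empty] at h1
      have h3 : p (ω 0) 0 < 1 := by
        rw [← hp1 (ω 0)]
        refine Finset.single_lt_sum (f := fun j => p (ω 0) j) (i := 0) (j := 1) (by norm_num)
          (Finset.mem_range.2 hj) (Finset.mem_range.2 (by have := hN (ω 0); omega))
          (hp _ _ (by have := hN (ω 0); omega)) ?_
        intro k hk _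
        exact (hp _ _ (Finset.mem_range.1 hk)).le
      have h4 : ENNReal.ofReal (p (ω 0) 0) = 1 := by
        rw [ENNReal.ofReal_one] at h1
        rw [h1]; simp
      rw [ENNReal.ofReal_eq_one] at h4
      linarith
  have hJd : ∀ σ, V σ → 0 < diam (J σ) := fun σ hσ => by
    rw [(hJall σ hσ).2.2]; exact mul_pos (hG0 σ hσ) hD0
  have hμP : ∀ σ, V σ → μ (J σ) = ENNReal.ofReal (P σ) := fun σ hσ => hμ σ hσ
  have hμK : μ (J []) = 1 := by rw [hμP [] hV0]; simp [hPdef, prodW_nil]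
  have hPdiam : ∀ σ, V σ → P σ * diam (J σ) ^ r = h σ * D ^ r := by
    intro σ hσ
    rw [(hJall σ hσ).2.2, hhPG σ hσ, Real.mul_rpow (hG0 σ hσ).le hD0.le]; ring
  -- ν versus h
  have hνh : ∀ σ, V σ → 0 ≤ ν σ ∧ h σ ^ t = ν σ * Real.exp (∑ l ∈ Finset.range σ.length, Real.log (F (ω l))) := by
    intro σ hσ
    refine valid_induction (N := N) (ω := ω) (P := fun σ => 0 ≤ ν σ ∧ h σ ^ t = ν σ *
      Real.exp (∑ l ∈ Finset.range σ.length, Real.log (F (ω l)))) ?_ ?_ σ hσ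
    · simp [hνdef, hhdef, prodW_nil]
    · rintro σ j hσ hj ⟨h1, h2⟩
      have h3 := (hh0 σ hσ).le
      have h4 := (ha0 _ _ hj)
      have h5 := hF0 (ω σ.length)
      simp only [hνdef, hhdef, prodW_append] at h1 h2 h3 ⊢
      refine ⟨by positivity, ?_⟩
      rw [Real.mul_rpow h3 h4.le, h2, List.length_append, List.length_singleton,
        Finset.sum_range_succ, Real.exp_add, Real.exp_log h5]
      field_simp
  have hνle : ∀ σ, V σ → h σ ^ t ≤ Real.exp M * ν σ := by
    intro σ hσ
    obtain ⟨h1, h2⟩ := hνh σ hσ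
    rw [h2, mul_comm]
    exact mul_le_mul_of_nonneg_right (Real.exp_le_exp.2 (abs_le.1 (hM σ.length)).2) h1
  have hνge : ∀ σ, V σ → Real.exp (-M) * ν σ ≤ h σ ^ t := by
    intro σ hσ
    obtain ⟨h1, h2⟩ := hνh σ hσ
    rw [h2, mul_comm (ν σ)]
    exact mul_le_mul_of_nonneg_right (Real.exp_le_exp.2 (abs_le.1 (hM σ.length)).1) h1
  -- cuts
  have hcut : ∀ ε : ℝ, 0 < ε → ε ≤ 1 → ∃ A : Finset (List ℕ),
      (∀ σ ∈ A, V σ ∧ η * ε ≤ h σ ∧ h σ < ε) ∧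
      (∀ σ ∈ A, ∀ τ ∈ A, σ ≠ τ → ∀ x ∈ J σ, ∀ y ∈ J τ,
        β * max (diam (J σ)) (diam (J τ)) ≤ dist x y) ∧
      ∑ σ ∈ A, P σ = 1 ∧ ∑ σ ∈ A, ν σ = 1 := by
    intro ε hε0 hε1
    obtain ⟨k, hk⟩ := exists_pow_lt_of_lt_one hε0 (show 1 - κ' < 1 by linarith)
    obtain ⟨A, hA1, hA2, hA3⟩ := exists_cut V b hV0 hV J (fun σ hσ => (hJall σ hσ).2.1)
      (fun σ hσ => (hJall σ hσ).1.isBounded) hJd hJsub β hβ hsep h (by simp [hhdef, prodW_nil])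
      η (1 - κ') ε hη0 hη1 (by linarith) hε1 hε0 (by
        intro σ hσ j hj
        have h1 := (hh0 σ hσ).le
        have h2 := hη _ _ hj
        have h3 := hκ' _ _ hj
        simp only [hhdef, prodW_append] at h1 ⊢
        constructor
        · rw [mul_comm]; exact mul_le_mul_of_nonneg_left h2 h1
        · rw [mul_comm]; exact mul_le_mul_of_nonneg_right (by linarith) h1) k
    refine ⟨A, ?_, hA2, ?_, ?_⟩
    · intro σ hσ
      obtain ⟨h1, h2, h3⟩ := hA1 σ hσ
      exact ⟨h1, h2, h3.elim id fun h => h.trans_lt hk⟩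
    · rw [hA3 P]
      · simp [hPdef, prodW_nil]
      · intro σ _
        simp only [hPdef, prodW_append]
        rw [← Finset.mul_sum, hp1, mul_one]
    · rw [hA3 ν]
      · simp [hνdef, prodW_nil]
      · intro σ _
        simp only [hνdef, prodW_append]
        rw [← Finset.mul_sum, ← Finset.sum_div]
        have := (hF0 (ω σ.length)).ne'
        rw [show (∑ j ∈ Finset.range (b σ), a (ω σ.length) j ^ t) = F (ω σ.length) from rfl,
          div_self this, mul_one]
  have hlim : ∀ C : ℝ, Tendsto (fun n : ℕ => (C / (n : ℝ)) ^ τ) atTop (nhds 0) := by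
    intro C
    have := (tendsto_const_div_atTop_nhds_zero_nat C).rpow_const (p := τ) (Or.inr hτ0.le)
    rwa [Real.zero_rpow hτ0.ne'] at this
  have hinv : ∀ x : ℝ, 0 ≤ x → (x ^ τ) ^ t = x := by
    intro x hx
    rw [← Real.rpow_mul hx, mul_comm, htinv, Real.rpow_one]
  have hnx : ∀ (n : ℕ) (C : ℝ), 1 ≤ n → 0 ≤ C → (n : ℝ) ^ τ * (C / n) ^ τ = C ^ τ := by
    intro n C hn hC
    have hn0 : (0 : ℝ) < n := by exact_mod_cast hn
    rw [← Real.mul_rpow hn0.le (by positivity)]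
    congr 1; field_simp
  refine coeff_of_bounds μ r sr (((Real.exp (-M) / 2) ^ τ * (η * D ^ r * (β / 2) ^ r)) ^ (1 / r))
    ((Real.exp M ^ τ / η * D ^ r) ^ (1 / r)) (by positivity) ?_ ?_
  · filter_upwards [(hlim (Real.exp (-M) / 2)).eventually_lt_const one_pos, eventually_ge_atTop 1]
      with n hn hn1
    have hn0 : (0 : ℝ) < n := by exact_mod_cast hn1
    set ε := (Real.exp (-M) / 2 / (n : ℝ)) ^ τ with hε
    have hε0 : 0 < ε := by positivity
    obtain ⟨A, hA1, hA2, hA3, hA4⟩ := hcut ε hε0 hn.le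
    have hεt : ε ^ t = Real.exp (-M) / 2 / n := hinv _ (by positivity)
    have hcard : 2 * n ≤ A.card := by
      have h1 : Real.exp (-M) ≤ A.card * ε ^ t := by
        calc Real.exp (-M) = ∑ σ ∈ A, Real.exp (-M) * ν σ := by
              rw [← Finset.mul_sum, hA4, mul_one]
          _ ≤ ∑ σ ∈ A, ε ^ t := Finset.sum_le_sum fun σ hσ =>
              (hνge σ (hA1 σ hσ).1).trans (Real.rpow_le_rpow (hh0 σ (hA1 σ hσ).1).le
                (hA1 σ hσ).2.2.le ht0.le)
          _ = _ := by simp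
      rw [hεt] at h1
      have h2 : (2 * n : ℝ) ≤ A.card := by
        have he := Real.exp_pos (-M)
        have h3 : (A.card : ℝ) * (Real.exp (-M) / 2 / n) = Real.exp (-M) * (A.card / (2 * n)) := by
          rw [div_div]; ring
        rw [h3] at h1
        have h4 : 1 ≤ (A.card : ℝ) / (2 * n) := by
          by_contra hlt
          push Not at hlt
          nlinarith
        rwa [one_le_div (by positivity)] at h4
      exact_mod_cast h2
    have hq := quant_lower μ (J []) hJ0.1 hμK r hr A n hn1 hcard J
      (fun σ hσ => (hJall σ (hA1 σ hσ).1).1) (fun σ hσ => hJd σ (hA1 σ hσ).1) β hβ hA2 P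
      (fun σ hσ => (hP0 σ (hA1 σ hσ).1).le) (fun σ hσ => hμP σ (hA1 σ hσ).1)
      (η * ε * D ^ r) (by positivity) (by
        intro σ hσ
        rw [hPdiam σ (hA1 σ hσ).1]
        exact mul_le_mul_of_nonneg_right (hA1 σ hσ).2.1 (by positivity))
    refine le_trans (le_of_eq ?_) (mul_le_mul_of_nonneg_left hq (by positivity))
    rw [rpow_combine _ _ _ _ hn0 (by positivity) hr hsr, ← hτ]
    congr 1
    rw [← hnx n _ hn1 (by positivity)]
    ring
  · filter_upwards [(hlim (Real.exp M)).eventually_lt_const hη0, eventually_ge_atTop 1]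
      with n hn hn1
    have hn0 : (0 : ℝ) < n := by exact_mod_cast hn1
    set ε := (Real.exp M / (n : ℝ)) ^ τ / η with hε
    have hε0 : 0 < ε := by positivity
    have hε1 : ε ≤ 1 := by rw [hε, div_le_one hη0]; exact hn.le
    obtain ⟨A, hA1, hA2, hA3, hA4⟩ := hcut ε hε0 hε1
    have hηε : η * ε = (Real.exp M / (n : ℝ)) ^ τ := by rw [hε]; field_simp
    have hεt : (η * ε) ^ t = Real.exp M / n := by rw [hηε]; exact hinv _ (by positivity)
    have hcard : A.card ≤ n := by
      have h1 : A.card * (η * ε) ^ t ≤ Real.exp M := by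
        calc A.card * (η * ε) ^ t = ∑ σ ∈ A, (η * ε) ^ t := by simp
          _ ≤ ∑ σ ∈ A, Real.exp M * ν σ := Finset.sum_le_sum fun σ hσ =>
              (Real.rpow_le_rpow (by positivity) (hA1 σ hσ).2.1 ht0.le).trans
                (hνle σ (hA1 σ hσ).1)
          _ = Real.exp M := by rw [← Finset.mul_sum, hA4, mul_one]
      rw [hεt] at h1
      have h2 : (A.card : ℝ) ≤ n := by
        have he := Real.exp_pos M
        have h3 : (A.card : ℝ) * (Real.exp M / n) = Real.exp M * (A.card / n) := by
          ring
        rw [h3] at h1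
        have h4 : (A.card : ℝ) / n ≤ 1 := by
          by_contra hlt
          push Not at hlt
          nlinarith
        rwa [div_le_one hn0] at h4
      exact_mod_cast h2
    have hq := quant_upper μ (J []) hJ0.1 hμK r hr A n hcard J
      (fun σ hσ => (hJall σ (hA1 σ hσ).1).1) (fun σ hσ => (hJall σ (hA1 σ hσ).1).2.1) (by
        intro σ hσ τ hτ hne
        rw [Function.onFun, Set.disjoint_left]
        intro x hx hx'
        have := hA2 σ hσ τ hτ hne x hx x hx'
        rw [dist_self] at this
        have hd : 0 < max (diam (J σ)) (diam (J τ)) := lt_max_of_lt_left (hJd σ (hA1 σ hσ).1)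
        nlinarith [mul_pos hβ hd]) P
      (fun σ hσ => (hP0 σ (hA1 σ hσ).1).le) (fun σ hσ => hμP σ (hA1 σ hσ).1) hA3
    have hsum : ∑ σ ∈ A, P σ * diam (J σ) ^ r ≤ n * (ε * D ^ r) := by
      calc ∑ σ ∈ A, P σ * diam (J σ) ^ r ≤ ∑ σ ∈ A, ε * D ^ r := by
            refine Finset.sum_le_sum fun σ hσ => ?_
            rw [hPdiam σ (hA1 σ hσ).1]
            exact mul_le_mul_of_nonneg_right (hA1 σ hσ).2.2.le (by positivity)
        _ = A.card * (ε * D ^ r) := by simp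
        _ ≤ _ := by gcongr
    have hq2 := hq.trans (Real.rpow_le_rpow (Finset.sum_nonneg fun σ hσ =>
      mul_nonneg (hP0 σ (hA1 σ hσ).1).le (Real.rpow_nonneg diam_nonneg _)) hsum
      (by positivity : 0 ≤ 1 / r))
    refine (mul_le_mul_of_nonneg_left hq2 (by positivity)).trans (le_of_eq ?_)
    rw [rpow_combine _ _ _ _ hn0 (by positivity) hr hsr, ← hτ]
    congr 1
    rw [← hnx n (Real.exp M) hn1 (by positivity), hε]
    ring

lemma log_sum_lip (n : ℕ) (hn : 2 ≤ n) (a : ℕ → ℝ) (η : ℝ) (hη : 0 < η)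
    (ha : ∀ j < n, η ≤ a j ∧ a j ≤ 1) (t t' : ℝ) :
    Real.log (∑ j ∈ Finset.range n, a j ^ t) - Real.log (∑ j ∈ Finset.range n, a j ^ t') ≤
      |t - t'| * (-Real.log η) := by
  have ha0 : ∀ j ∈ Finset.range n, 0 < a j := fun j hj =>
    hη.trans_le (ha j (Finset.mem_range.1 hj)).1
  have hne : (Finset.range n).Nonempty := ⟨0, Finset.mem_range.2 (by omega)⟩
  have hp : ∀ t : ℝ, 0 < ∑ j ∈ Finset.range n, a j ^ t := fun t =>
    Finset.sum_pos (fun j hj => Real.rpow_pos_of_pos (ha0 j hj) _) hne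
  rw [sub_le_iff_le_add, ← Real.log_exp (|t - t'| * (-Real.log η)),
    ← Real.log_mul (Real.exp_pos _).ne' (hp t').ne']
  refine Real.log_le_log (hp t) ?_
  rw [Finset.mul_sum]
  refine Finset.sum_le_sum fun j hj => ?_
  obtain ⟨h1, h2⟩ := ha j (Finset.mem_range.1 hj)
  have h0 := ha0 j hj
  rw [Real.rpow_def_of_pos h0, Real.rpow_def_of_pos h0, ← Real.exp_add]
  refine Real.exp_le_exp.2 ?_
  have h3 : Real.log η ≤ Real.log (a j) := Real.log_le_log hη h1
  have h4 : Real.log (a j) ≤ 0 := Real.log_nonpos h0.le h2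
  have h5 : Real.log (a j) * (t - t') ≤ |t - t'| * (-Real.log (a j)) := by
    have := neg_abs_le (t - t')
    nlinarith
  have h6 : |t - t'| * (-Real.log (a j)) ≤ |t - t'| * (-Real.log η) :=
    mul_le_mul_of_nonneg_left (by linarith) (abs_nonneg _)
  nlinarith

lemma sum_freq {m : ℕ} (ω : ℕ → Fin m) (k : ℕ) (f : Fin m → ℝ) :
    ∑ l ∈ Finset.range k, f (ω l) = ∑ i, (freqCount ω k i : ℝ) * f i := by
  rw [← Finset.sum_fiberwise (Finset.range k) ω]
  refine Finset.sum_congr rfl fun i _ => ?_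
  rw [Finset.sum_congr rfl (g := fun _ => f i) (fun l hl => by rw [(Finset.mem_filter.1 hl).2])]
  simp [freqCount]

lemma sum_log_of_prod {m : ℕ} (F : Fin m → ℝ) (hF : ∀ i, 0 < F i) (x : Fin m → ℝ)
    (h : ∏ i, F i ^ x i = 1) : ∑ i, x i * Real.log (F i) = 0 := by
  have := congrArg Real.log h
  rw [Real.log_prod (fun i _ => (Real.rpow_pos_of_pos (hF i) _).ne'), Real.log_one] at this
  rw [← this]
  exact Finset.sum_congr rfl fun i _ => (Real.log_rpow (hF i) _).symm

end MoranAux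

/-- in the multiscale Moran setting with `ω ∈ G(χ)`, if
`H̄_r(ω) = limsup_k k|s_{k,r}(ω) − s_r| < ∞` (i.e. `k|s_{k,r}(ω) − s_r|` is eventually
bounded), then `Q̲_r^{s_r}(μ_ω)` and `Q̄_r^{s_r}(μ_ω)` are both positive and finite.
In particular this holds whenever `ω ∈ G₀(χ)`, i.e. `|N_{k,i}(ω) − kχ_i|` is bounded
for each `i`. -/
theorem quantCoeff_multiscale_moran_positive_finite
    (d m : ℕ) (hm : 2 ≤ m)
    (N : Fin m → ℕ) (hN : ∀ i, 2 ≤ N i)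
    (g : Fin m → ℕ → ℝ) (hg : ∀ i, ∀ j < N i, 0 < g i j ∧ g i j < 1)
    (p : Fin m → ℕ → ℝ) (hp : ∀ i, ∀ j < N i, 0 < p i j)
    (hp1 : ∀ i, ∑ j ∈ Finset.range (N i), p i j = 1)
    (χ : Fin m → ℝ) (hχ : ∀ i, 0 < χ i) (hχ1 : ∑ i, χ i = 1)
    (ω : ℕ → Fin m)
    (hωG : ∀ i, Tendsto (fun k => (freqCount ω k i : ℝ) / (k : ℝ)) atTop (nhds (χ i)))
    (J : List ℕ → Set (EuclideanSpace ℝ (Fin d)))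
    (hJ0 : IsCompact (J []) ∧ (J []).Nonempty ∧ J [] = closure (interior (J [])))
    (hJsub : ∀ σ : List ℕ, ValidWord N ω σ → ∀ j < N (ω σ.length), J (σ ++ [j]) ⊆ J σ)
    (hJsim : ∀ σ : List ℕ, ValidWord N ω σ → ∀ j < N (ω σ.length),
      ∃ S : EuclideanSpace ℝ (Fin d) → EuclideanSpace ℝ (Fin d),
        (∀ x y, dist (S x) (S y) = g (ω σ.length) j * dist x y) ∧ S '' J σ = J (σ ++ [j]))
    (hsep : ∃ β : ℝ, 0 < β ∧ β < 1 ∧ ∀ σ : List ℕ, ValidWord N ω σ →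
      ∀ j₁ j₂ : ℕ, j₁ < N (ω σ.length) → j₂ < N (ω σ.length) → j₁ ≠ j₂ →
      ∀ x ∈ J (σ ++ [j₁]), ∀ y ∈ J (σ ++ [j₂]),
        β * max (diam (J (σ ++ [j₁]))) (diam (J (σ ++ [j₂]))) ≤ dist x y)
    (μ : Measure (EuclideanSpace ℝ (Fin d))) [IsProbabilityMeasure μ]
    (hμ : ∀ σ : List ℕ, ValidWord N ω σ →
      μ (J σ) = ENNReal.ofReal (∏ l : Fin σ.length, p (ω l) (σ.get l)))
    (r sr : ℝ) (hr : 0 < r) (hsr : 0 < sr)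
    (hsreq : ∏ i, (∑ j ∈ Finset.range (N i), (p i j * g i j ^ r) ^ (sr / (sr + r))) ^ (χ i) = 1)
    (sk : ℕ → ℝ) (hsk : ∀ k, 0 < sk k)
    (hskeq : ∀ k, ∏ i, (∑ j ∈ Finset.range (N i),
      (p i j * g i j ^ r) ^ (sk k / (sk k + r))) ^ (freqCount ω k i : ℝ) = 1) :
    ((IsBoundedUnder (· ≤ ·) atTop fun k : ℕ => (k : ℝ) * |sk k - sr|) →
      0 < lowerQuantCoeff μ r sr ∧ lowerQuantCoeff μ r sr ≤ upperQuantCoeff μ r sr ∧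
        upperQuantCoeff μ r sr < ∞) ∧
    ((∀ i, IsBoundedUnder (· ≤ ·) atTop fun k : ℕ => |(freqCount ω k i : ℝ) - k * χ i|) →
      0 < lowerQuantCoeff μ r sr ∧ lowerQuantCoeff μ r sr ≤ upperQuantCoeff μ r sr ∧
        upperQuantCoeff μ r sr < ∞) := by
  have hple : ∀ i, ∀ j < N i, p i j ≤ 1 := by
    intro i j hj
    rw [← hp1 i]
    exact Finset.single_le_sum (f := fun j => p i j)
      (fun j hj => (hp i j (Finset.mem_range.1 hj)).le) (Finset.mem_range.2 hj)
  have ha0 : ∀ i, ∀ j < N i, 0 < p i j * g i j ^ r := fun i j hj =>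
    mul_pos (hp i j hj) (Real.rpow_pos_of_pos (hg i j hj).1 _)
  have ha1 : ∀ i, ∀ j < N i, p i j * g i j ^ r ≤ 1 := fun i j hj =>
    mul_le_one₀ (hple i j hj) (Real.rpow_nonneg (hg i j hj).1.le _)
      (Real.rpow_le_one (hg i j hj).1.le (hg i j hj).2.le hr.le)
  have hF0 : ∀ (t : ℝ) i, 0 < ∑ j ∈ Finset.range (N i), (p i j * g i j ^ r) ^ t := fun t i =>
    Finset.sum_pos (fun j hj => Real.rpow_pos_of_pos (ha0 i j (Finset.mem_range.1 hj)) _)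
      ⟨0, Finset.mem_range.2 (by have := hN i; omega)⟩
  have hcore := MoranAux.core d m N hN g hg p hp hp1 ω J hJ0 hJsub hJsim hsep μ hμ r sr hr hsr
  constructor
  · intro hbdd
    obtain ⟨B, hB⟩ := hbdd.bddAbove_range
    obtain ⟨η, hη0, hη1, hη⟩ := MoranAux.exists_lower N _ ha0
    have hL : 0 ≤ -Real.log η := by
      have := Real.log_nonpos hη0.le hη1
      linarith
    refine hcore (B / r * (-Real.log η)) fun k => ?_
    have hB' : (k : ℝ) * |sk k - sr| ≤ B := hB ⟨k, rfl⟩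
    set t := sr / (sr + r) with ht
    set t' := sk k / (sk k + r) with ht'
    have hzero : ∑ l ∈ Finset.range k, Real.log (∑ j ∈ Finset.range (N (ω l)),
        (p (ω l) j * g (ω l) j ^ r) ^ t') = 0 := by
      rw [MoranAux.sum_freq ω k (fun i => Real.log (∑ j ∈ Finset.range (N i),
        (p i j * g i j ^ r) ^ t'))]
      exact MoranAux.sum_log_of_prod _ (hF0 t') _ (hskeq k)
    have htt : |t - t'| ≤ |sk k - sr| / r := by
      have hk0 := hsk k
      have : t - t' = (sr - sk k) * (r / ((sr + r) * (sk k + r))) := by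
        rw [ht, ht']; field_simp; ring
      rw [this, abs_mul, abs_sub_comm, div_eq_mul_one_div _ r]
      refine mul_le_mul_of_nonneg_left ?_ (abs_nonneg _)
      rw [abs_of_pos (by positivity), div_le_div_iff₀ (by positivity) hr]
      nlinarith [mul_pos hsr hk0, mul_pos hsr hr, mul_pos hk0 hr]
    rw [← sub_zero (∑ l ∈ Finset.range k, _), ← hzero, ← Finset.sum_sub_distrib]
    refine (Finset.abs_sum_le_sum_abs _ _).trans ?_
    calc _ ≤ ∑ l ∈ Finset.range k, |t - t'| * (-Real.log η) := by
          refine Finset.sum_le_sum fun l _ => ?_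
          have hcond : ∀ j < N (ω l), η ≤ p (ω l) j * g (ω l) j ^ r ∧
            p (ω l) j * g (ω l) j ^ r ≤ 1 := fun j hj => ⟨hη _ j hj, ha1 _ j hj⟩
          have h1 := MoranAux.log_sum_lip (N (ω l)) (hN _) (fun j => p (ω l) j * g (ω l) j ^ r)
            η hη0 hcond t t'
          have h2 := MoranAux.log_sum_lip (N (ω l)) (hN _) (fun j => p (ω l) j * g (ω l) j ^ r)
            η hη0 hcond t' t
          rw [abs_sub_comm t' t] at h2
          rw [abs_le]
          constructor <;> linarith
      _ = (k * |t - t'|) * (-Real.log η) := by simp; ring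
      _ ≤ B / r * (-Real.log η) := by
          refine mul_le_mul_of_nonneg_right ?_ hL
          calc (k : ℝ) * |t - t'| ≤ k * (|sk k - sr| / r) :=
                mul_le_mul_of_nonneg_left htt (Nat.cast_nonneg k)
            _ = k * |sk k - sr| / r := by ring
            _ ≤ B / r := by gcongr
  · intro hbdd
    have : ∀ i, ∃ B : ℝ, ∀ k : ℕ, |(freqCount ω k i : ℝ) - k * χ i| ≤ B := by
      intro i
      obtain ⟨B, hB⟩ := (hbdd i).bddAbove_range
      exact ⟨B, fun k => hB ⟨k, rfl⟩⟩
    choose B hB using this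
    have hz := MoranAux.sum_log_of_prod _ (hF0 (sr / (sr + r))) χ hsreq
    refine hcore (∑ i, B i * |Real.log (∑ j ∈ Finset.range (N i),
      (p i j * g i j ^ r) ^ (sr / (sr + r)))|) fun k => ?_
    rw [MoranAux.sum_freq ω k (fun i => Real.log (∑ j ∈ Finset.range (N i),
        (p i j * g i j ^ r) ^ (sr / (sr + r)))),
      ← sub_zero (∑ i, _), ← mul_zero (k : ℝ), ← hz, Finset.mul_sum, ← Finset.sum_sub_distrib]
    refine (Finset.abs_sum_le_sum_abs _ _).trans (Finset.sum_le_sum fun i _ => ?_)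
    rw [← mul_assoc, ← sub_mul, abs_mul]
    exact mul_le_mul_of_nonneg_right (hB i k) (abs_nonneg _)
end
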